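/- In U = U_q(A(0,2)^{(4)})^+, for every n ≥ 1 the following eight identities hold (all brackets below are plain commutators, with the conventions L₀ = L₀′ = θ⁻¹·1): [X₁, L_{2n}] = Σ_{i=0}^{n−1} P_{2n−1−2i}·θ·L_{2i}X_{2n+1−2i} − Σ_{i=0}^{n−1} P_{2n−2−2i}·θ·L′_{2i+1}X_{2n−2i}; [X₁, L′_{2n}] = Σ_{i=0}^{n−1} q^{2n−1−2i}·θ·L′_{2i}X_{2n+1−2i} − Σ_{i=0}^{n−1} q^{2n−2−2i}·θ·L_{2i+1}X_{2n−2i}; [X₂, L_{2n}] = Σ_{i=0}^{n−1} q^{2n−1−2i}·θ·L_{2i}X_{2n+2−2i} + Σ_{i=0}^{n−1} q^{2n−2−2i}·θ·L′_{2i+1}X_{2n−2i+1}; [X₂, L′_{2n}] = Σ_{i=0}^{n−1} Q_{2n−1−2i}·θ·L′_{2i}X_{2n+2−2i} + Σ_{i=0}^{n−1} Q_{2n−2−2i}·θ·L_{2i+1}X_{2n−2i+1}; [L_{2n}, Y₁] = Σ_{i=0}^{n−1} q^{2n−1−2i}·θ·Y_{2n+1−2i}L_{2i} + Σ_{i=0}^{n−1}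 q^{2n−2−2i}·θ·Y_{2n−2i}L_{2i+1}; [L′_{2n}, Y₁] = Σ_{i=0}^{n−1} Q_{2n−1−2i}·θ·Y_{2n+1−2i}L′_{2i} + Σ_{i=0}^{n−1} Q_{2n−2−2i}·θ·Y_{2n−2i}L′_{2i+1}; [L_{2n}, Y₂] = Σ_{i=0}^{n−1} P_{2n−1−2i}·θ·Y_{2n+2−2i}L_{2i} − Σ_{i=0}^{n−1} P_{2n−2−2i}·θ·Y_{2n−2i+1}L_{2i+1}; [L′_{2n}, Y₂] = Σ_{i=0}^{n−1} q^{2n−1−2i}·θ·Y_{2n+2−2i}L′_{2i} − Σ_{i=0}^{n−1} q^{2n−2−2i}·θ·Y_{2n−2i+1}L′_{2i+1}. -/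

import Mathlib

noncomputable section

namespace QAff

abbrev F : Type := FreeAlgebra ℂ (Fin 2)

def x1 : F := FreeAlgebra.ι ℂ 0
def x2 : F := FreeAlgebra.ι ℂ 1

def θ (q : ℂ) : ℂ := q - q⁻¹

def L1F (q : ℂ) : F := x1 * x2 - q⁻¹ • (x2 * x1)

def X2F (q : ℂ) : F := x1 * L1F q - L1F q * x1

def Y2F (q : ℂ) : F := L1F q * x2 + x2 * L1F q

/-- the quantum Serre relator `[x₁,[x₁,[x₁,x₂]]]` (braided brackets w.r.t. the bicharacter
`χ((a,b),(c,d)) = (-1)^(bd) q^(ac-ad-bc+bd)`). -/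
def serre1 (q : ℂ) : F := x1 * X2F q - q • (X2F q * x1)

/-- the quantum Serre relator `[[[x₁,x₂],x₂],x₂]` (braided brackets). -/
def serre2 (q : ℂ) : F := Y2F q * x2 - q • (x2 * Y2F q)

inductive Rel (q : ℂ) : F → F → Prop
  | one : Rel q (serre1 q) 0
  | two : Rel q (serre2 q) 0

/-- `U = U_q(A(0,2)^{(4)})^+`, the free algebra on `x₁, x₂` modulo the two-sided ideal
generated by the quantum Serre relators. -/
abbrev U (q : ℂ) : Type := RingQuot (Rel q)

def π (q : ℂ) : F →ₐ[ℂ] U q := RingQuot.mkAlgHom ℂ (Rel q)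

/-- `L₁ = [X₁,Y₁] = x₁x₂ - q⁻¹ x₂x₁` in `U`. -/
def L1U (q : ℂ) : U q := π q x1 * π q x2 - q⁻¹ • (π q x2 * π q x1)

/-- real root vectors `X_n`, `n ≥ 1` (`X 0 := 0` is junk):
`X₁ = x₁`, `X_{n+1} = [X_n, L₁] = X_n L₁ - (-1)^(n-1) L₁ X_n`
(the braiding scalar is `χ((n,n-1),(1,1)) = (-1)^(n-1)`). -/
def X (q : ℂ) : ℕ → U q
  | 0 => 0
  | 1 => π q x1
  | (n+2) => X q (n+1) * L1U q - ((-1 : ℂ)^n) • (L1U q * X q (n+1))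

/-- real root vectors `Y_n`, `n ≥ 1` (`Y 0 := 0` is junk):
`Y₁ = x₂`, `Y_{n+1} = [L₁, Y_n] = L₁ Y_n - (-1)^n Y_n L₁`
(the braiding scalar is `χ((1,1),(n-1,n)) = (-1)^n`). -/
def Y (q : ℂ) : ℕ → U q
  | 0 => 0
  | 1 => π q x2
  | (n+2) => L1U q * Y q (n+1) - ((-1 : ℂ)^(n+1)) • (Y q (n+1) * L1U q)

/-- `L₀ = θ⁻¹·1`, and `L_n = [X₁, Y_n] = X₁Y_n - q⁻¹ Y_n X₁` for `n ≥ 1`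
(the braiding scalar is `χ((1,0),(n-1,n)) = q⁻¹`). -/
def L (q : ℂ) : ℕ → U q
  | 0 => (θ q)⁻¹ • 1
  | (n+1) => X q 1 * Y q (n+1) - q⁻¹ • (Y q (n+1) * X q 1)

/-- `L₀′ = θ⁻¹·1`, `L₁′ = L₁`, and
`L_n′ = [X₂, Y_{n-1}] = X₂Y_{n-1} - (-1)^(n-1) q⁻¹ Y_{n-1}X₂` for `n ≥ 2`
(the braiding scalar is `χ((2,1),(n-2,n-1)) = (-1)^(n-1) q⁻¹`). -/
def L' (q : ℂ) : ℕ → U q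
  | 0 => (θ q)⁻¹ • 1
  | 1 => L q 1
  | (n+2) => X q 2 * Y q (n+1) - ((-1 : ℂ)^(n+1) * q⁻¹) • (Y q (n+1) * X q 2)

/-- `M q n` is the element `M_{2n+1}`:  `M₁ = L₁`, `M_{2n+1} = [L₂, M_{2n-1}]`
(a plain commutator, the braiding scalar being `1`). -/
def M (q : ℂ) : ℕ → U q
  | 0 => L q 1
  | (n+1) => L q 2 * M q n - M q n * L q 2

/-- `L̃_n = (L_n + L_n′)/2`, with the convention `L̃_n = 0` for `n < 0`
(note `L̃₀ = θ⁻¹·1`). -/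
def Lt (q : ℂ) (n : ℤ) : U q :=
  if 0 ≤ n then ((2 : ℂ)⁻¹) • (L q n.toNat + L' q n.toNat) else 0

/-- `L̂_{n+1} = [L_n, L₁] = L_n L₁ - (-1)^n L₁ L_n`
(the braiding scalar is `χ((n,n),(1,1)) = (-1)^n`); in particular `L̂₁ = 0`. -/
def Lhat (q : ℂ) : ℕ → U q
  | 0 => 0
  | (n+1) => L q n * L q 1 - ((-1 : ℂ)^n) • (L q 1 * L q n)

/-- the sequence `P₀ = 1`, `P_n = q^n + q^(n-1) + (-1)^(n-1) P_(n-1)`. -/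
def P (q : ℂ) : ℕ → ℂ
  | 0 => 1
  | (n+1) => q^(n+1) + q^n + (-1 : ℂ)^n * P q n

/-- the sequence `Q₀ = 1`, `Q_n = q^n - q^(n-1) + (-1)^n Q_(n-1)`. -/
def Q (q : ℂ) : ℕ → ℂ
  | 0 => 1
  | (n+1) => q^(n+1) - q^n + (-1 : ℂ)^(n+1) * Q q n

/-- `q` is not a root of unity. -/
def NotRootOfUnity (q : ℂ) : Prop := ∀ n : ℕ, n ≠ 0 → q ^ n ≠ 1

end QAff

open QAff

namespace QAff

variable {q : ℂ}

/-- `ε n = (-1)^n` as a complex scalar. -/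
def ε (n : ℕ) : ℂ := (-1) ^ n

lemma ε_even {n : ℕ} (h : Even n) : ε n = 1 := h.neg_one_pow
lemma ε_odd {n : ℕ} (h : Odd n) : ε n = -1 := h.neg_one_pow

/-- Real root vectors `x k = X_{k+1}`, `y k = Y_{k+1}` in a `ℂ`-algebra, together with the imaginary
root vector `l = L₁`, subject to the quantum Serre relations. -/
structure RootSystem (q : ℂ) (A : Type*) [Ring A] [Algebra ℂ A] where
  x : ℕ → A
  y : ℕ → A
  l : A
  l_eq : l = x 0 * y 0 - q⁻¹ • (y 0 * x 0)
  x_succ : ∀ k, x (k + 1) = x k * l - ε k • (l * x k)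
  y_succ : ∀ k, y (k + 1) = l * y k + ε k • (y k * l)
  serre_x : x 0 * x 1 = q • (x 1 * x 0)
  serre_y : y 1 * y 0 = q • (y 0 * y 1)

namespace RootSystem

variable {A : Type*} [Ring A] [Algebra ℂ A] (s : RootSystem q A)

/-- The braided bracket of `x k` and `y m`. -/
def e (k m : ℕ) : A := s.x k * s.y m - (ε (k * (m + 1)) * q⁻¹) • (s.y m * s.x k)

/-- `fam 0 = L`, `fam 1 = L'`, and `fam c` depends only on the parity of `c`. -/
def fam (s : RootSystem q A) : ℕ → ℕ → A
  | 0, 0 => (θ q)⁻¹ • 1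
  | 0, n + 1 => s.e 0 n
  | 1, 0 => (θ q)⁻¹ • 1
  | 1, 1 => s.e 0 0
  | 1, n + 2 => s.e 1 n
  | c + 2, n => s.fam c n

lemma base_x (hq : q ≠ 0) (h3 : q ^ 2 + q + 1 ≠ 0) :
    s.x 1 * s.e 0 1 - s.e 0 1 * s.x 1 = q • (s.x 2 * s.l) - q⁻¹ • (s.l * s.x 2) := by
  have h1 := s.serre_x
  have h2 := s.serre_y
  have hx1 := s.x_succ 0
  have hx2 := s.x_succ 1
  have hy1 := s.y_succ 0
  simp only [e, hx2, hy1, hx1, zero_add] at *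
  rw [s.l_eq] at *
  generalize s.x 0 = x at *
  generalize s.y 0 = y at *
  rw [← sub_eq_zero] at h1 h2 ⊢
  refine (smul_eq_zero_iff_right h3).1 ?_
  linear_combination (norm := skip)
    (-2*q) • (h1 * x * y * y) +
    (-q) • (x * h1 * y * y) +
    (-q⁻¹-q+q^2) • (x * y * h1 * y) +
    (q⁻¹+1) • (x * y * y * h1) +
    (1-q+q^2) • (h1 * y * x * y) +
    (-q⁻¹^2+q⁻¹+1) • (y * h1 * x * y) +
    (q⁻¹+1-q) • (y * x * h1 * y) +
    (q⁻¹^3-q⁻¹^2+q⁻¹) • (y * x * y * h1) +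
    (q⁻¹+1) • (h1 * y * y * x) +
    (q⁻¹^3-q⁻¹^2-1) • (y * h1 * y * x) +
    (-q⁻¹^2) • (y * y * h1 * x) +
    (-2*q⁻¹^2) • (y * y * x * h1) +
    (-q⁻¹^2) • (h2 * x * x * x) +
    (q⁻¹^2+q⁻¹+1) • (x * h2 * x * x) +
    (-(q⁻¹+1+q)) • (x * x * h2 * x) +
    (q) • (x * x * x * h2)
  simp only [ε, mul_add, add_mul, mul_sub, sub_mul, smul_mul_assoc, mul_smul_comm, mul_assoc, smul_add,
    smul_sub, smul_smul, mul_zero, zero_mul]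
  match_scalars <;> field_simp <;> ring

lemma base_y (hq : q ≠ 0) (h3 : q ^ 2 - q + 1 ≠ 0) :
    s.e 1 0 * s.y 1 - s.y 1 * s.e 1 0 = q • (s.l * s.y 2) + q⁻¹ • (s.y 2 * s.l) := by
  have h1 := s.serre_x
  have h2 := s.serre_y
  have hx1 := s.x_succ 0
  have hy1 := s.y_succ 0
  have hy2 := s.y_succ 1
  simp only [e, hy2, hy1, hx1, zero_add] at *
  rw [s.l_eq] at *
  generalize s.x 0 = x at *
  generalize s.y 0 = y at *
  rw [← sub_eq_zero] at h1 h2 ⊢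
  refine (smul_eq_zero_iff_right h3).1 ?_
  linear_combination (norm := skip)
    (-q) • (h1 * y * y * y) +
    (-(q⁻¹-1+q)) • (y * h1 * y * y) +
    (q⁻¹^2-q⁻¹+1) • (y * y * h1 * y) +
    (q⁻¹^2) • (y * y * y * h1) +
    (-q⁻¹+1) • (h2 * x * x * y) +
    (-q⁻¹-q-q^2) • (x * h2 * x * y) +
    (q) • (x * x * h2 * y) +
    (-2*q) • (x * x * y * h2) +
    (q⁻¹^3+q⁻¹^2+q⁻¹) • (h2 * x * y * x) +
    (-q⁻¹+1+q) • (x * h2 * y * x) +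
    (q⁻¹^2+q⁻¹-1) • (x * y * h2 * x) +
    (1+q+q^2) • (x * y * x * h2) +
    (-2*q⁻¹^2) • (h2 * y * x * x) +
    (q⁻¹^2) • (y * h2 * x * x) +
    (-q⁻¹^3-q⁻¹^2-1) • (y * x * h2 * x) +
    (q⁻¹-1) • (y * x * x * h2)
  simp only [ε, mul_add, add_mul, mul_sub, sub_mul, smul_mul_assoc, mul_smul_comm, mul_assoc, smul_add,
    smul_sub, smul_smul, mul_zero, zero_mul]
  match_scalars <;> field_simp <;> ring

end RootSystem

lemma ε_cases (n : ℕ) : ε n = 1 ∨ ε n = -1 := neg_one_pow_eq_or ℂ n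
lemma ε_zero : ε 0 = 1 := pow_zero _
lemma ε_one : ε 1 = -1 := pow_one _
lemma ε_add (m n : ℕ) : ε (m + n) = ε m * ε n := pow_add _ _ _
lemma ε_mul_self (n : ℕ) : ε n * ε n = 1 := by
  rcases ε_cases n with h | h <;> simp [h]
lemma ε_add_two_mul (a b : ℕ) : ε (a + 2 * b) = ε a := by
  rw [ε_add, two_mul, ε_add, ε_mul_self, mul_one]

namespace RootSystem

variable {A : Type*} [Ring A] [Algebra ℂ A] (s : RootSystem q A)

lemma fam_add_two (c n : ℕ) : s.fam (c + 2) n = s.fam c n := rfl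

lemma fam_congr : ∀ {c c' : ℕ}, c % 2 = c' % 2 → ∀ n, s.fam c n = s.fam c' n
  | 0, 0, _, _ => rfl
  | 1, 1, _, _ => rfl
  | 0, 1, h, _ => by simp at h
  | 1, 0, h, _ => by simp at h
  | c + 2, c', h, n => fam_congr (c := c) (c' := c') (by omega) n
  | 0, c' + 2, h, n => fam_congr (c := 0) (c' := c') (by omega) n
  | 1, c' + 2, h, n => fam_congr (c := 1) (c' := c') (by omega) n

lemma fam_zero : ∀ c, s.fam c 0 = (θ q)⁻¹ • 1
  | 0 => rfl
  | 1 => rfl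
  | c + 2 => fam_zero c

lemma l_eq_e : s.l = s.e 0 0 := by rw [s.l_eq]; simp [e, ε_zero]

lemma fam_one : ∀ c, s.fam c 1 = s.l
  | 0 => s.l_eq_e.symm
  | 1 => s.l_eq_e.symm
  | c + 2 => fam_one c

lemma fam_zero_succ (n : ℕ) : s.fam 0 (n + 1) = s.e 0 n := rfl
lemma fam_one_add_two (n : ℕ) : s.fam 1 (n + 2) = s.e 1 n := rfl

lemma odd_der_e (k m : ℕ) :
    s.l * s.e k m - ε (k + m + 1) • (s.e k m * s.l) = ε k • (s.e k (m + 1) - s.e (k + 1) m) := by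
  simp only [e, x_succ, y_succ, mul_add, add_mul, mul_sub, sub_mul, smul_mul_assoc, mul_smul_comm,
    mul_assoc, smul_add, smul_sub, smul_smul, ε_add, mul_one, one_mul, ε_one]
  rcases ε_cases k with hk | hk <;> rcases ε_cases m with hm | hm <;> simp only [hk, hm] <;>
  match_scalars <;> ring

lemma sq_comm_x (k : ℕ) : s.l * s.l * s.x k - s.x k * (s.l * s.l) = -s.x (k + 2) := by
  simp only [x_succ, mul_sub, sub_mul, smul_mul_assoc, mul_smul_comm,
    mul_assoc, smul_sub, smul_smul, ε_add, ε_one]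
  rcases ε_cases k with hk | hk <;> simp only [hk] <;> match_scalars <;> ring

lemma sq_comm_y (k : ℕ) : s.l * s.l * s.y k - s.y k * (s.l * s.l) = s.y (k + 2) := by
  simp only [y_succ, mul_add, add_mul, smul_mul_assoc, mul_smul_comm,
    mul_assoc, smul_add, smul_smul, ε_add, ε_one]
  rcases ε_cases k with hk | hk <;> simp only [hk] <;> match_scalars <;> ring

lemma sq_comm_e (k m : ℕ) :
    s.l * s.l * s.e k m - s.e k m * (s.l * s.l) = s.e k (m + 2) - s.e (k + 2) m := by
  have h1 := s.sq_comm_x k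
  have h2 := s.sq_comm_y m
  have e1 : ε (k * (m + 2 + 1)) = ε (k * (m + 1)) := by
    rw [show k * (m + 2 + 1) = k * (m + 1) + 2 * k by ring, ε_add_two_mul]
  have e2 : ε ((k + 2) * (m + 1)) = ε (k * (m + 1)) := by
    rw [add_mul, ε_add_two_mul]
  simp only [e, e1, e2]
  linear_combination (norm := skip) h1 * s.y m + s.x k * h2
    - (ε (k * (m + 1)) * q⁻¹) • (h2 * s.x k + s.y m * h1)
  simp only [mul_add, mul_sub, sub_mul, smul_mul_assoc, mul_smul_comm, mul_neg, neg_mul,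
    mul_assoc, smul_add, smul_sub, smul_neg]
  match_scalars <;> ring

lemma fam_one_eq (m : ℕ) : s.fam 1 (m + 2) = s.fam 0 (m + 2) -
    (s.l * s.fam 0 (m + 1) - ε (m + 1) • (s.fam 0 (m + 1) * s.l)) := by
  have h := s.odd_der_e 0 m
  rw [zero_add, ε_zero, one_smul] at h
  rw [fam_zero_succ, fam_zero_succ, fam_one_add_two, h, zero_add, sub_sub_cancel]

/-- `L_i` commutes with `L₁²` for `i ≤ d`. -/
def Central (d : ℕ) : Prop := ∀ i ≤ d, Commute (s.l * s.l) (s.fam 0 i)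

variable {s} {d : ℕ}

lemma Central.fam (h : s.Central d) (c : ℕ) {i : ℕ} (hi : i ≤ d) :
    Commute (s.l * s.l) (s.fam c i) := by
  have hl : Commute (s.l * s.l) s.l := (Commute.refl s.l).mul_left (Commute.refl s.l)
  induction c using Nat.twoStepInduction with
  | zero => exact h i hi
  | one =>
    rcases i with _ | _ | m
    · exact h 0 hi
    · exact h 1 hi
    · rw [fam_one_eq]
      have := h (m + 1) (by omega)
      exact (h _ hi).sub_right ((hl.mul_right this).sub_right ((this.mul_right hl).smul_right _))
  | more c ih _ => exact ih

lemma Central.e_eq (h : s.Central d) {k m : ℕ} (hk : k + m ≤ d + 1) :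
    s.e k m = s.fam k (k + m + 1) := by
  induction k using Nat.twoStepInduction generalizing m with
  | zero => rw [zero_add, fam_zero_succ]
  | one => rw [add_comm 1 m, fam_one_add_two]
  | more k ih _ =>
    have h1 := s.sq_comm_e k m
    rw [ih (by omega), (h.fam k (by omega)).eq, sub_self, ih (by omega), eq_comm, sub_eq_zero] at h1
    rw [← h1, fam_add_two]
    congr 1; omega

variable (s)

lemma serre_x_two : s.x 0 * s.x 2 - q • (s.x 2 * s.x 0) = (1 + q) • (s.x 1 * s.x 1) := by
  have h := s.serre_x
  have hx1 := s.x_succ 0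
  have hx2 := s.x_succ 1
  simp only [zero_add, ε_zero, ε_one, one_add_one_eq_two] at *
  rw [← sub_eq_zero] at h
  linear_combination (norm := skip) s.l * h + h * s.l
  rw [hx2]
  simp only [hx1, add_mul, mul_sub, sub_mul, smul_mul_assoc, mul_smul_comm,
    mul_assoc, smul_sub, smul_smul, mul_zero, zero_mul]
  match_scalars <;> ring

lemma serre_y_two : s.y 2 * s.y 0 + q • (s.y 0 * s.y 2) = (q - 1) • (s.y 1 * s.y 1) := by
  have h := s.serre_y
  have hy1 := s.y_succ 0
  have hy2 := s.y_succ 1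
  simp only [zero_add, ε_zero, ε_one, one_add_one_eq_two] at *
  rw [← sub_eq_zero] at h
  linear_combination (norm := skip) s.l * h + h * s.l
  rw [hy2]
  simp only [hy1, mul_add, add_mul, mul_sub, sub_mul, smul_mul_assoc, mul_smul_comm,
    mul_assoc, smul_add, smul_smul, mul_zero, zero_mul]
  match_scalars <;> ring

end RootSystem

lemma NotRootOfUnity.ne_zero_of_dvd (hq : NotRootOfUnity q) {n : ℕ} (hn : n ≠ 0) {c d : ℂ}
    (h : c * d = q ^ n - 1) : c ≠ 0 := by
  rintro rfl
  rw [zero_mul, eq_comm, sub_eq_zero] at h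
  exact hq n hn h

lemma NotRootOfUnity.θ_ne_zero (hq : NotRootOfUnity q) (hq0 : q ≠ 0) : θ q ≠ 0 := by
  refine hq.ne_zero_of_dvd (n := 2) (d := q) two_ne_zero ?_
  rw [θ]; field_simp

namespace RootSystem

variable {A : Type*} [Ring A] [Algebra ℂ A] (s : RootSystem q A) {d : ℕ}

/-- The bracket of `x k` with `fam (k + 1) a`. -/
def hx (a k : ℕ) : A := s.x k * s.fam (k + 1) a - ε (k * a) • (s.fam (k + 1) a * s.x k)

/-- The bracket of `fam (m + a) a` with `y m`. -/
def gy (a m : ℕ) : A :=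
  s.fam (m + a) a * s.y m - ε ((m + 1) * a) • (s.y m * s.fam (m + a) a)

lemma hx_one (hθ : θ q ≠ 0) (k : ℕ) : s.hx 1 k = q • (s.x (k + 1) * s.fam k 0)
    - (ε ((k + 1) * 0) * q⁻¹) • (s.fam k 0 * s.x (k + 1)) := by
  rw [hx, fam_one, fam_zero, mul_one, mul_zero, ε_zero, ← x_succ]
  rw [mul_smul_comm, smul_mul_assoc, mul_one, one_mul, one_mul, smul_smul, smul_smul, ← sub_smul,
    ← sub_mul, ← θ, mul_inv_cancel₀ hθ, one_smul]

lemma gy_one (hθ : θ q ≠ 0) (m : ℕ) : s.gy 1 m = q • (s.fam (m + 1) 0 * s.y (m + 1))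
    - (ε (m * 0) * q⁻¹) • (s.y (m + 1) * s.fam (m + 1) 0) := by
  rw [gy, fam_one, fam_zero, mul_one, mul_zero, ε_zero, ε_add, ε_one, mul_neg_one, neg_smul,
    sub_neg_eq_add, ← y_succ]
  rw [mul_smul_comm, smul_mul_assoc, mul_one, one_mul, one_mul, smul_smul, smul_smul, ← sub_smul,
    ← sub_mul, ← θ, mul_inv_cancel₀ hθ, one_smul]

lemma hx_zero_right (hq0 : q ≠ 0) (a : ℕ) : s.hx (a + 2) 0 = q • (s.x 1 * s.fam 0 (a + 1))
    - (ε (a + 1) * q⁻¹) • (s.fam 0 (a + 1) * s.x 1) := by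
  have h := s.serre_x
  rw [hx, zero_add, zero_mul, ε_zero, fam_one_add_two, fam_zero_succ]
  simp only [e, zero_mul, ε_zero, one_mul]
  rw [← sub_eq_zero] at h
  linear_combination (norm := skip) h * s.y a - (ε (a + 1) * q⁻¹ ^ 2) • (s.y a * h)
  simp only [mul_sub, sub_mul, smul_mul_assoc, mul_smul_comm, mul_assoc, smul_sub, smul_smul,
    mul_zero, zero_mul]
  match_scalars <;> field_simp <;> ring

lemma comm_x_fam_two (hq : NotRootOfUnity q) (hq0 : q ≠ 0) :
    s.x 1 * s.fam 0 2 - s.fam 0 2 * s.x 1 = q • (s.x 2 * s.l) - q⁻¹ • (s.l * s.x 2) :=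
  s.base_x hq0 (hq.ne_zero_of_dvd (n := 3) three_ne_zero (d := q - 1) (by ring))

lemma comm_fam_two_y (hq : NotRootOfUnity q) (hq0 : q ≠ 0) :
    s.fam 1 2 * s.y 1 - s.y 1 * s.fam 1 2 = q • (s.l * s.y 2) + q⁻¹ • (s.y 2 * s.l) :=
  s.base_y hq0 (hq.ne_zero_of_dvd (n := 6) (by norm_num) (d := (q + 1) * (q ^ 3 - 1)) (by ring))

lemma fam_zero_two : s.fam 0 2 = s.fam 1 2 + (2 : ℂ) • (s.l * s.l) := by
  rw [fam_one_eq, zero_add, fam_one, ε_one]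
  module

lemma comm_x_zero_fam_two (hq0 : q ≠ 0) : s.x 0 * s.fam 0 2 - s.fam 0 2 * s.x 0 =
    (q + 2) • s.x 2 - θ q • (s.l * s.x 1) := by
  have h := s.hx_zero_right hq0 0
  have h2 := s.sq_comm_x 0
  have h3 := s.x_succ 1
  simp only [hx, zero_add, zero_mul, ε_zero, ε_one, fam_one, one_smul] at h h2 h3
  rw [fam_zero_two]
  linear_combination (norm := skip) h - (2 : ℂ) • h2 
  simp only [h3, θ, mul_add, add_mul, smul_mul_assoc, mul_smul_comm,
    mul_assoc, smul_sub, smul_smul]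
  match_scalars <;> ring

lemma bracket_e_y_zero (hq0 : q ≠ 0) (k : ℕ) : s.e k 1 * s.y 0 - ε k • (s.y 0 * s.e k 1) =
    q • (s.e k 0 * s.y 1) - q⁻¹ • (s.y 1 * s.e k 0) := by
  have h := s.serre_y
  rw [← sub_eq_zero] at h
  simp only [e, zero_add, mul_one, one_add_one_eq_two, mul_two, ε_add, ε_mul_self, one_mul]
  linear_combination (norm := skip) s.x k * h - (ε k * q⁻¹ ^ 2) • (h * s.x k)
  simp only [mul_sub, sub_mul, smul_mul_assoc, mul_smul_comm, mul_assoc, smul_sub, smul_smul,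
    mul_zero, zero_mul]
  match_scalars <;> field_simp <;> ring

lemma comm_fam_two_y_zero (hq0 : q ≠ 0) : s.fam 1 2 * s.y 0 - s.y 0 * s.fam 1 2 =
    (q - 2) • s.y 2 + θ q • (s.y 1 * s.l) := by
  have h := s.bracket_e_y_zero hq0 0
  have h2 := s.sq_comm_y 0
  have h3 := s.y_succ 1
  simp only [zero_add, ε_one] at h2 h3
  rw [ε_zero, one_smul, ← l_eq_e, ← fam_zero_succ, fam_zero_two] at h
  linear_combination (norm := skip) h - (2 : ℂ) • h2 
  simp only [h3, θ, mul_add, add_mul, sub_mul, smul_mul_assoc, mul_smul_comm,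
    mul_assoc, smul_add, smul_sub, smul_smul]
  match_scalars <;> ring

lemma serre_x_one (hq : NotRootOfUnity q) (hq0 : q ≠ 0) :
    s.x 1 * s.x 2 = q • (s.x 2 * s.x 1) := by
  have hS := s.serre_x
  have hT := s.serre_x_two
  have hC := s.comm_x_fam_two hq hq0
  have hA := s.comm_x_zero_fam_two hq0
  have hx1 := s.x_succ 0
  have hx2 := s.x_succ 1
  simp only [zero_add, ε_zero, ε_one, one_add_one_eq_two] at hx1 hx2
  have h4 : 1 + q ^ 2 ≠ 0 := hq.ne_zero_of_dvd (n := 4) four_ne_zero (d := q ^ 2 - 1) (by ring)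
  generalize s.fam 0 2 = M at *
  rw [← sub_eq_zero] at hS hT ⊢
  refine (smul_eq_zero_iff_right h4).1 ?_
  linear_combination (norm := skip) (-q) • (hS * M - M * hS - hA * s.x 1 - s.x 0 * hC
    + q • (hC * s.x 0) + q • (s.x 1 * hA)) + q ^ 2 • (hT * s.l) - s.l * hT
  rw [hx2]
  simp only [hx1, θ, mul_add, add_mul, mul_sub, sub_mul, smul_mul_assoc, mul_smul_comm,
    mul_assoc, smul_add, smul_sub, smul_smul, mul_zero, zero_mul]
  match_scalars <;> field_simp <;> ring

lemma serre_y_one (hq : NotRootOfUnity q) (hq0 : q ≠ 0) :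
    s.y 2 * s.y 1 = q • (s.y 1 * s.y 2) := by
  have hS := s.serre_y
  have hT := s.serre_y_two
  have hC := s.comm_fam_two_y hq hq0
  have hA := s.comm_fam_two_y_zero hq0
  have hy1 := s.y_succ 0
  have hy2 := s.y_succ 1
  simp only [zero_add, ε_zero, ε_one, one_add_one_eq_two] at hy1 hy2
  have h4 : 1 + q ^ 2 ≠ 0 := hq.ne_zero_of_dvd (n := 4) four_ne_zero (d := q ^ 2 - 1) (by ring)
  generalize s.fam 1 2 = M at *
  rw [← sub_eq_zero] at hS hT ⊢
  refine (smul_eq_zero_iff_right h4).1 ?_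
  linear_combination (norm := skip) q • (M * hS - hS * M - hC * s.y 0 - s.y 1 * hA
    + q • (hA * s.y 1) + q • (s.y 0 * hC)) - q ^ 2 • (s.l * hT) + hT * s.l
  rw [hy2]
  simp only [hy1, θ, mul_add, add_mul, mul_sub, sub_mul, smul_mul_assoc, mul_smul_comm,
    mul_assoc, smul_add, smul_sub, smul_smul, mul_zero, zero_mul]
  match_scalars <;> field_simp <;> ring

lemma bracket_x_one_e (hq : NotRootOfUnity q) (hq0 : q ≠ 0) (m : ℕ) :
    s.x 1 * s.e 2 m - ε (m + 1) • (s.e 2 m * s.x 1) =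
      q • (s.x 2 * s.e 1 m) - q⁻¹ • (s.e 1 m * s.x 2) := by
  have h := s.serre_x_one hq hq0
  rw [← sub_eq_zero] at h
  simp only [e, one_mul, two_mul, ε_add (m + 1) (m + 1), ε_mul_self]
  linear_combination (norm := skip) h * s.y m - (ε (m + 1) * q⁻¹ ^ 2) • (s.y m * h)
  simp only [mul_sub, sub_mul, smul_mul_assoc, mul_smul_comm, mul_assoc, smul_sub, smul_smul,
    mul_zero, zero_mul]
  match_scalars <;> field_simp <;> ring

lemma bracket_e_y_one (hq : NotRootOfUnity q) (hq0 : q ≠ 0) (k : ℕ) :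
    s.e k 2 * s.y 1 - s.y 1 * s.e k 2 =
      q • (s.e k 1 * s.y 2) - (ε k * q⁻¹) • (s.y 2 * s.e k 1) := by
  have h := s.serre_y_one hq hq0
  rw [← sub_eq_zero] at h
  simp only [e, show k * (2 + 1) = k + 2 * k by ring, show k * (1 + 1) = 0 + 2 * k by ring,
    ε_add_two_mul, ε_zero, one_mul]
  linear_combination (norm := skip) s.x k * h - (ε k * q⁻¹ ^ 2) • (h * s.x k)
  simp only [mul_sub, sub_mul, smul_mul_assoc, mul_smul_comm, mul_assoc, smul_sub, smul_smul,
    mul_zero, zero_mul]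
  match_scalars <;> field_simp <;> ring

end RootSystem

namespace RootSystem

variable {A : Type*} [Ring A] [Algebra ℂ A] (s : RootSystem q A) {d : ℕ}

lemma x_add_two (k : ℕ) : s.x (k + 2) = s.x k * (s.l * s.l) - s.l * s.l * s.x k := by
  rw [← neg_sub, sq_comm_x, neg_neg]

lemma y_add_two (k : ℕ) : s.y (k + 2) = s.l * s.l * s.y k - s.y k * (s.l * s.l) :=
  (s.sq_comm_y k).symm

variable {s}

lemma Central.hx_succ (h : s.Central d) (hq : NotRootOfUnity q) (hq0 : q ≠ 0) {a k : ℕ}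
    (hak : a + k ≤ d + 1) : s.hx (a + 1) k = q • (s.x (k + 1) * s.fam k a)
      - (ε ((k + 1) * a) * q⁻¹) • (s.fam k a * s.x (k + 1)) := by
  induction k using Nat.twoStepInduction with
  | zero =>
    rcases a with _ | a
    · exact s.hx_one (hq.θ_ne_zero hq0) 0
    · rw [zero_add, one_mul, hx_zero_right _ hq0]
  | one =>
    rcases a with _ | _ | a
    · exact s.hx_one (hq.θ_ne_zero hq0) 1
    · have h1 := s.comm_x_fam_two hq hq0
      simpa [hx, fam_one, fam_add_two, ε, mul_comm] using h1
    · have h1 := s.bracket_x_one_e hq hq0 a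
      rw [h.e_eq (by omega)] at h1
      rw [hx, fam_one_add_two, show 2 + a + 1 = a + 3 by ring] at *
      rw [show 1 * (a + 2 + 1) = a + 1 + 2 * 1 by ring, ε_add_two_mul,
        show (1 + 1) * (a + 2) = 0 + 2 * (a + 2) by ring, ε_add_two_mul, ε_zero, one_mul]
      exact h1
  | more k ih _ =>
    rcases a with _ | a
    · exact s.hx_one (hq.θ_ne_zero hq0) (k + 2)
    have hF := (h.fam (k + 1) (i := a + 2) (by omega)).eq
    have hG := (h.fam k (i := a + 1) (by omega)).eq
    have ih := ih (by omega)
    rw [hx] at ih ⊢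
    rw [show (k + 2) * (a + 1 + 1) = k * (a + 1 + 1) + 2 * (a + 1 + 1) by ring, ε_add_two_mul,
      show (k + 2 + 1) * (a + 1) = (k + 1) * (a + 1) + 2 * (a + 1) by ring, ε_add_two_mul,
      show k + 2 + 1 = k + 1 + 2 by ring, fam_add_two, fam_add_two, x_add_two, x_add_two]
    generalize s.l * s.l = z at *
    linear_combination (norm := skip) ih * z - z * ih + s.x k * hF
      - ε (k * (a + 1 + 1)) • (hF * s.x k) - q • (s.x (k + 1) * hG)
      + (ε ((k + 1) * (a + 1)) * q⁻¹) • (hG * s.x (k + 1))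
    simp only [mul_sub, sub_mul, smul_mul_assoc, mul_smul_comm, mul_assoc, smul_sub]
    match_scalars <;> ring

lemma Central.gy_succ (h : s.Central d) (hq : NotRootOfUnity q) (hq0 : q ≠ 0) {a m : ℕ}
    (ham : a + m ≤ d + 1) : s.gy (a + 1) m = q • (s.fam (m + a + 1) a * s.y (m + 1))
      - (ε (m * a) * q⁻¹) • (s.y (m + 1) * s.fam (m + a + 1) a) := by
  induction m using Nat.twoStepInduction with
  | zero =>
    rcases a with _ | a
    · exact s.gy_one (hq.θ_ne_zero hq0) 0
    · have h1 := s.bracket_e_y_zero hq0 a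
      rw [h.e_eq (by omega), h.e_eq (by omega)] at h1
      rw [gy, show (0 + 1) * (a + 1 + 1) = a + 2 * 1 by ring, ε_add_two_mul, zero_mul, ε_zero,
        one_mul, zero_add, show 0 + (a + 1) + 1 = a + 2 by ring, fam_add_two, fam_add_two]
      exact h1
  | one =>
    rcases a with _ | _ | a
    · exact s.gy_one (hq.θ_ne_zero hq0) 1
    · have h1 := s.comm_fam_two_y hq hq0
      simpa [gy, fam_one, fam_add_two, ε, pow_succ] using h1
    · have h1 := s.bracket_e_y_one hq hq0 a
      rw [h.e_eq (by omega), h.e_eq (by omega)] at h1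
      rw [gy, show (1 + 1) * (a + 2 + 1) = 0 + 2 * (a + 3) by ring, ε_add_two_mul, ε_zero, one_smul,
        show 1 * (a + 2) = a + 2 * 1 by ring, ε_add_two_mul,
        show 1 + (a + 2 + 1) = a + 2 + 2 by ring, show 1 + (a + 2) + 1 = a + 2 + 2 by ring]
      exact h1
  | more m ih _ =>
    rcases a with _ | a
    · exact s.gy_one (hq.θ_ne_zero hq0) (m + 2)
    have hF := (h.fam (m + (a + 1 + 1)) (i := a + 2) (by omega)).eq
    have hG := (h.fam (m + (a + 1) + 1) (i := a + 1) (by omega)).eq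
    have ih := ih (by omega)
    rw [gy] at ih ⊢
    rw [show (m + 2 + 1) * (a + 1 + 1) = (m + 1) * (a + 1 + 1) + 2 * (a + 1 + 1) by ring,
      ε_add_two_mul, show (m + 2) * (a + 1) = m * (a + 1) + 2 * (a + 1) by ring, ε_add_two_mul,
      show m + 2 + (a + 1 + 1) = m + (a + 1 + 1) + 2 by ring,
      show m + 2 + (a + 1) + 1 = m + (a + 1) + 1 + 2 by ring,
      show m + 2 + 1 = m + 1 + 2 by ring, fam_add_two, fam_add_two, y_add_two, y_add_two]
    generalize s.l * s.l = z at *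
    linear_combination (norm := skip) z * ih - ih * z - hF * s.y m
      + ε ((m + 1) * (a + 1 + 1)) • (s.y m * hF) + q • (hG * s.y (m + 1))
      - (ε (m * (a + 1)) * q⁻¹) • (s.y (m + 1) * hG)
    simp only [mul_sub, sub_mul, smul_mul_assoc, mul_smul_comm, mul_assoc, smul_sub]
    match_scalars <;> ring

/-- Recursive form of the bracket `hx`. -/
lemma Central.hx_rec (h : s.Central d) (hq : NotRootOfUnity q) (hq0 : q ≠ 0) {a k : ℕ}
    (hak : a + k ≤ d + 1) : s.hx (a + 1) k = q • s.hx a (k + 1)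
      + (ε ((k + 1) * a) * θ q) • (s.fam k a * s.x (k + 1)) := by
  rw [h.hx_succ hq hq0 hak, hx, fam_add_two, θ]
  module

/-- Recursive form of the bracket `gy`. -/
lemma Central.gy_rec (h : s.Central d) (hq : NotRootOfUnity q) (hq0 : q ≠ 0) {a m : ℕ}
    (ham : a + m ≤ d + 1) : s.gy (a + 1) m = q • s.gy a (m + 1)
      + (ε (m * a) * θ q) • (s.y (m + 1) * s.fam (m + a + 1) a) := by
  rw [h.gy_succ hq hq0 ham, gy, show m + 1 + 1 = m + 2 by rfl, add_mul m 2, ε_add_two_mul,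
    add_right_comm, θ]
  module

lemma hx_zero (k : ℕ) : s.hx 0 k = 0 := by
  simp [hx, fam_zero, ε_zero]

lemma gy_zero (k : ℕ) : s.gy 0 k = 0 := by
  simp [gy, fam_zero, ε_zero]

end RootSystem

lemma ε_congr {a b : ℕ} (h : Even a ↔ Even b) : ε a = ε b := by
  by_cases ha : Even a
  · rw [ε_even ha, ε_even (h.1 ha)]
  · rw [ε_odd (Nat.not_even_iff_odd.1 ha), ε_odd (Nat.not_even_iff_odd.1 (mt h.2 ha))]

/-- Reflection of a double sum over triples `i + u + v = a` with `u, v ≥ 1`. -/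
lemma sum_triangle_swap {M : Type*} [AddCommMonoid M] (F : ℕ → ℕ → ℕ → M) (a : ℕ) :
    ∑ j ∈ Finset.range a, ∑ i ∈ Finset.range j, F i (j - i) (a - j) =
      ∑ j ∈ Finset.range a, ∑ i ∈ Finset.range j, F i (a - j) (j - i) := by
  rw [Finset.sum_sigma', Finset.sum_sigma']
  refine Finset.sum_nbij' (fun p ↦ ⟨a - p.1 + p.2, p.2⟩) (fun p ↦ ⟨a - p.1 + p.2, p.2⟩)
    ?_ ?_ ?_ ?_ ?_
  all_goals
    rintro ⟨j, i⟩ h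
    simp only [Finset.mem_sigma, Finset.mem_range] at h
  · simp only [Finset.mem_sigma, Finset.mem_range]; omega
  · simp only [Finset.mem_sigma, Finset.mem_range]; omega
  · simp only [Sigma.mk.injEq, heq_eq_eq, and_true]; omega
  · simp only [Sigma.mk.injEq, heq_eq_eq, and_true]; omega
  · congr 1 <;> simp only <;> omega

namespace RootSystem

variable {A : Type*} [Ring A] [Algebra ℂ A] {s : RootSystem q A} {d : ℕ}

lemma Central.hx_sum (h : s.Central d) (hq : NotRootOfUnity q) (hq0 : q ≠ 0) {a k : ℕ}
    (hak : a + k ≤ d + 2) : s.hx a k = ∑ j ∈ Finset.range a,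
      (ε ((a + k + 1) * j) * θ q * q ^ (a - 1 - j)) •
        (s.fam (k + 1 + a + j) j * s.x (k + a - j)) := by
  induction a generalizing k with
  | zero => simp [hx_zero]
  | succ a ih =>
    rw [h.hx_rec hq hq0 (by omega), ih (by omega), Finset.sum_range_succ, Finset.smul_sum]
    congr 1
    · refine Finset.sum_congr rfl fun j hj ↦ ?_
      have hj := Finset.mem_range.1 hj
      rw [smul_smul, show a + 1 - 1 - j = a - 1 - j + 1 by omega, pow_succ,
        show a + (k + 1) + 1 = a + 1 + k + 1 by ring, show k + 1 + a - j = k + (a + 1) - j by omega,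
        show k + 1 + 1 + a + j = k + 1 + (a + 1) + j by ring]
      congr 1; ring
    · rw [show a + 1 - 1 - a = 0 by omega, pow_zero, mul_one, show k + (a + 1) - a = k + 1 by omega,
        s.fam_congr (c := k + 1 + (a + 1) + a) (c' := k) (by omega)]
      congr 2
      refine ε_congr ?_
      simp only [parity_simps]; tauto

lemma Central.gy_sum (h : s.Central d) (hq : NotRootOfUnity q) (hq0 : q ≠ 0) {a m : ℕ}
    (ham : a + m ≤ d + 2) : s.gy a m = ∑ j ∈ Finset.range a,
      (ε ((m + a) * j) * θ q * q ^ (a - 1 - j)) • (s.y (m + a - j) * s.fam (m + a) j) := by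
  induction a generalizing m with
  | zero => simp [gy_zero]
  | succ a ih =>
    rw [h.gy_rec hq hq0 (by omega), ih (by omega), Finset.sum_range_succ, Finset.smul_sum]
    congr 1
    · refine Finset.sum_congr rfl fun j hj ↦ ?_
      have hj := Finset.mem_range.1 hj
      rw [smul_smul, show a + 1 - 1 - j = a - 1 - j + 1 by omega, pow_succ,
        show m + 1 + a = m + (a + 1) by ring]
      congr 1; ring
    · rw [show a + 1 - 1 - a = 0 by omega, pow_zero, mul_one, show m + (a + 1) - a = m + 1 by omega]
      congr 2
      refine ε_congr ?_
      simp only [parity_simps]; tauto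

lemma Central.sum_hx_gy (h : s.Central d) (hq : NotRootOfUnity q) (hq0 : q ≠ 0) {a m : ℕ}
    (ha : Odd a) (hm : Even m) (ham : a + m ≤ d + 2) :
    ∑ j ∈ Finset.range a, (ε j * q ^ (a - 1 - j)) •
      (s.y (m + a - j) * s.hx j 0 + s.gy j m * s.x (a - j)) = 0 := by
  let F (i u v : ℕ) : A := (ε (u + i + u * i) * θ q * q ^ (a - 2 - i)) •
    (s.y (m + v) * s.fam (1 + u) i * s.x u)
  have h1 : ∑ j ∈ Finset.range a, (ε j * q ^ (a - 1 - j)) • (s.y (m + a - j) * s.hx j 0) =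
      ∑ j ∈ Finset.range a, ∑ i ∈ Finset.range j, F i (j - i) (a - j) := by
    refine Finset.sum_congr rfl fun j hj ↦ ?_
    have hj := Finset.mem_range.1 hj
    rw [h.hx_sum hq hq0 (by omega), Finset.mul_sum, Finset.smul_sum]
    refine Finset.sum_congr rfl fun i hi ↦ ?_
    have hi := Finset.mem_range.1 hi
    obtain ⟨u, rfl⟩ := Nat.exists_eq_add_of_lt hi
    have e1 : ε (i + u + 1) * ε ((i + u + 1 + 0 + 1) * i) = ε ((u + 1) + i + (u + 1) * i) := by
      rw [← ε_add]; refine ε_congr ?_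
      simp only [parity_simps]; tauto
    rw [mul_smul_comm, smul_smul]
    simp only [F]
    rw [show i + u + 1 - i = u + 1 by omega, ← e1,
      s.fam_congr (c := 0 + 1 + (i + u + 1) + i) (c' := 1 + (u + 1)) (by omega),
      show m + a - (i + u + 1) = m + (a - (i + u + 1)) by omega,
      show 0 + (i + u + 1) - i = u + 1 by omega,
      show a - 2 - i = (a - 1 - (i + u + 1)) + (i + u + 1 - 1 - i) by omega, pow_add]
    congr 1
    · ring
    · rw [mul_assoc]
  have h2 : ∑ j ∈ Finset.range a, (ε j * q ^ (a - 1 - j)) • (s.gy j m * s.x (a - j)) =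
      - ∑ j ∈ Finset.range a, ∑ i ∈ Finset.range j, F i (a - j) (j - i) := by
    rw [← Finset.sum_neg_distrib]
    refine Finset.sum_congr rfl fun j hj ↦ ?_
    have hj := Finset.mem_range.1 hj
    rw [h.gy_sum hq hq0 (by omega), Finset.sum_mul, Finset.smul_sum, ← Finset.sum_neg_distrib]
    refine Finset.sum_congr rfl fun i hi ↦ ?_
    have hi := Finset.mem_range.1 hi
    obtain ⟨u, rfl⟩ := Nat.exists_eq_add_of_lt hj
    have e1 : ε j * ε ((m + j) * i) = - ε ((u + 1) + i + (u + 1) * i) := by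
      rw [← ε_add, ← neg_one_mul, ← ε_one, ← ε_add]; refine ε_congr ?_
      rw [← Nat.not_even_iff_odd] at ha
      simp only [parity_simps, Nat.not_even_one, hm] at *
      tauto
    rw [smul_mul_assoc, smul_smul]
    simp only [F]
    rw [show j + u + 1 - j = u + 1 by omega, ← neg_smul, ← neg_mul, ← neg_mul, ← e1,
      s.fam_congr (c := m + j) (c' := 1 + (u + 1)) (by
        obtain ⟨r, hr⟩ := ha; obtain ⟨t, rfl⟩ := hm; omega),
      show m + j - i = m + (j - i) by omega,
      show j + u + 1 - 2 - i = (j + u + 1 - 1 - j) + (j - 1 - i) by omega, pow_add]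
    congr 1
    ring
  simp only [smul_add, Finset.sum_add_distrib]
  rw [h1, h2, sum_triangle_swap, add_neg_cancel]

end RootSystem

namespace RootSystem

variable {A : Type*} [Ring A] [Algebra ℂ A] {s : RootSystem q A} {d : ℕ}

lemma Central.anticomm_fam_e (h : s.Central d) (hq : NotRootOfUnity q) (hq0 : q ≠ 0) {a m : ℕ}
    (ha : Odd a) (hm : Even m) (ham : a + m ≤ d + 2) :
    s.fam 1 a * s.e 0 m + s.e 0 m * s.fam 1 a = ∑ j ∈ Finset.range a, (θ q * q ^ (a - 1 - j)) •
      (ε j • (s.e 0 (m + a - j) * s.fam 1 j) - s.fam j j * s.e (a - j) m) := by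
  have hma : (m + a) % 2 = 1 := Nat.odd_iff.1 (hm.add_odd ha)
  have hx := h.hx_sum hq hq0 (a := a) (k := 0) (by omega)
  have hy := h.gy_sum hq hq0 ham
  have hs := h.sum_hx_gy hq hq0 ha hm ham
  rw [RootSystem.hx, zero_mul, ε_zero, one_smul, zero_add] at hx
  rw [gy, ε_odd (hm.add_one.mul ha), s.fam_congr (c := m + a) (c' := 1) hma, neg_one_smul,
    sub_neg_eq_add] at hy
  have key : s.fam 1 a * s.e 0 m + s.e 0 m * s.fam 1 a =
      s.x 0 * (s.fam 1 a * s.y m + s.y m * s.fam 1 a)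
      - (s.x 0 * s.fam 1 a - s.fam 1 a * s.x 0) * s.y m
      - q⁻¹ • (s.y m * (s.x 0 * s.fam 1 a - s.fam 1 a * s.x 0))
      - q⁻¹ • ((s.fam 1 a * s.y m + s.y m * s.fam 1 a) * s.x 0)
      - (θ q * q⁻¹) • ∑ j ∈ Finset.range a, (ε j * q ^ (a - 1 - j)) •
        (s.y (m + a - j) * s.hx j 0 + s.gy j m * s.x (a - j)) := by
    rw [hs, e, zero_mul, ε_zero]
    simp only [mul_add, add_mul, mul_sub, sub_mul, smul_mul_assoc, mul_smul_comm, mul_assoc,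
      smul_add, smul_sub, smul_zero]
    match_scalars <;> ring
  rw [key, hx, hy]
  simp only [Finset.mul_sum, Finset.sum_mul, Finset.smul_sum, ← Finset.sum_sub_distrib]
  refine Finset.sum_congr rfl fun j hj ↦ ?_
  have hj := Finset.mem_range.1 hj
  have hodd := Nat.odd_iff.1 ha
  have heven := Nat.even_iff.1 hm
  have e1 : ε ((m + a) * j) = ε j := by
    rw [← Nat.not_even_iff_odd] at ha
    refine ε_congr ?_
    simp only [parity_simps, hm]; tauto
  have e2 : ε ((a + 1) * j) = 1 := ε_even (ha.add_one.mul_right j)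
  have e3 : ε ((a - j) * (m + 1)) = - ε j := by
    rw [← neg_one_mul, ← ε_one, ← ε_add]
    refine ε_congr ?_
    obtain ⟨u, rfl⟩ := Nat.exists_eq_add_of_lt hj
    rw [← Nat.not_even_iff_odd] at ha
    rw [show j + u + 1 - j = u + 1 by omega]
    simp only [parity_simps, hm, Nat.not_even_one] at *; tauto
  have e4 : ε ((m + 1) * j) = ε j := by
    refine ε_congr ?_
    simp only [parity_simps, hm] at *; tauto
  rw [RootSystem.hx, gy, e, e, e1, add_zero a, e2, e3, e4,
    s.fam_congr (c := m + a) (c' := 1) hma, s.fam_congr (c := 1 + a + j) (c' := j) (by omega),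
    s.fam_congr (c := m + j) (c' := j) (by omega)]
  simp only [zero_add, zero_mul, ε_zero, mul_add, mul_sub, sub_mul, smul_mul_assoc,
    mul_smul_comm, mul_assoc, smul_add, smul_sub, smul_smul]
  have hε := ε_cases j
  generalize ε j = r at *
  generalize q ^ (a - 1 - j) = p
  rcases hε with rfl | rfl <;>
  match_scalars <;> ring

end RootSystem

namespace RootSystem

variable {A : Type*} [Ring A] [Algebra ℂ A] {s : RootSystem q A} {d : ℕ}

variable (s) in
/-- The commutator of `L₁²` with `L_n`. -/
def sqComm (n : ℕ) : A := s.l * s.l * s.fam 0 n - s.fam 0 n * (s.l * s.l)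

lemma Central.sqComm_fam (h : s.Central d) (c : ℕ) :
    s.l * s.l * s.fam c (d + 1) - s.fam c (d + 1) * (s.l * s.l) = s.sqComm (d + 1) := by
  induction c using Nat.twoStepInduction with
  | zero => rfl
  | one =>
    rcases d with _ | d
    · rfl
    · have hl : Commute (s.l * s.l) s.l := (Commute.refl s.l).mul_left (Commute.refl s.l)
      have hd := h (d + 1) le_rfl
      have h1 := (hl.mul_right hd).sub_right ((hd.mul_right hl).smul_right (ε (d + 1)))
      rw [fam_one_eq, mul_sub, sub_mul, h1.eq, sqComm]
      abel
  | more c ih _ => exact ih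

lemma Central.e_add_two (h : s.Central d) {k m : ℕ} (hk : k + m = d) :
    s.e (k + 2) m = s.e k (m + 2) - s.sqComm (d + 1) := by
  have h1 := s.sq_comm_e k m
  rw [h.e_eq (by omega), hk, h.sqComm_fam] at h1
  rw [h1, sub_sub_cancel]

lemma Central.comm_x_fam_zero_two (h : s.Central 2) (hq0 : q ≠ 0) (i : ℕ) :
    s.x (2 * i) * s.fam 0 2 - s.fam 0 2 * s.x (2 * i) =
      (q + 2) • s.x (2 * i + 2) - θ q • (s.l * s.x (2 * i + 1)) := by
  induction i with
  | zero => exact s.comm_x_zero_fam_two hq0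
  | succ i ih =>
    have h2 := (h 2 le_rfl).eq
    rw [show 2 * (i + 1) = 2 * i + 2 by ring, show 2 * i + 2 + 1 = 2 * i + 1 + 2 by ring,
      x_add_two _ (2 * i + 2), x_add_two _ (2 * i + 1)]
    linear_combination (norm := skip) ih * (s.l * s.l) - s.l * s.l * ih
      + s.x (2 * i) * h2 - h2 * s.x (2 * i)
    rw [x_add_two]
    simp only [mul_sub, sub_mul, smul_mul_assoc, mul_smul_comm, mul_assoc, smul_sub]
    match_scalars <;> ring

lemma Central.comm_fam_zero_two_y (h : s.Central 2) (hq0 : q ≠ 0) (i : ℕ) :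
    s.fam 0 2 * s.y (2 * i) - s.y (2 * i) * s.fam 0 2 =
      q • s.y (2 * i + 2) + θ q • (s.y (2 * i + 1) * s.l) := by
  induction i with
  | zero =>
    have h1 := s.comm_fam_two_y_zero hq0
    have h2 := s.sq_comm_y 0
    rw [s.fam_zero_two]
    linear_combination (norm := skip) h1 + (2 : ℂ) • h2
    simp only [mul_add, add_mul, smul_mul_assoc, mul_smul_comm, mul_assoc,
      smul_sub, mul_zero, zero_add]
    match_scalars <;> ring
  | succ i ih =>
    have h2 := (h 2 le_rfl).eq
    rw [show 2 * (i + 1) = 2 * i + 2 by ring, show 2 * i + 2 + 1 = 2 * i + 1 + 2 by ring,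
      y_add_two _ (2 * i + 2), y_add_two _ (2 * i + 1)]
    linear_combination (norm := skip) s.l * s.l * ih - ih * (s.l * s.l)
      - h2 * s.y (2 * i) + s.y (2 * i) * h2
    rw [y_add_two]
    simp only [mul_sub, sub_mul, mul_add, add_mul, smul_mul_assoc, mul_smul_comm, mul_assoc,
      smul_sub]
    match_scalars <;> ring

lemma Central.comm_fam_two_e (h : s.Central 2) (hq0 : q ≠ 0) (i j : ℕ) :
    s.fam 0 2 * s.e (2 * i) (2 * j) - s.e (2 * i) (2 * j) * s.fam 0 2 =
      q • s.e (2 * i) (2 * j + 2) - (q + 2) • s.e (2 * i + 2) (2 * j)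
      + θ q • (s.l * s.e (2 * i + 1) (2 * j) + s.e (2 * i) (2 * j + 1) * s.l) := by
  have hx := h.comm_x_fam_zero_two hq0 i
  have hy := h.comm_fam_zero_two_y hq0 j
  have hx' := s.x_succ (2 * i)
  have hy' := s.y_succ (2 * j)
  have hi : Even (2 * i) := even_two_mul i
  have hj : Even (2 * j) := even_two_mul j
  rw [ε_even hi, one_smul] at hx'
  rw [ε_even hj, one_smul] at hy'
  have key : s.y (2 * j + 1) * (s.x (2 * i) * s.l - s.l * s.x (2 * i)) =
    (s.l * s.y (2 * j) + s.y (2 * j) * s.l) * s.x (2 * i + 1) := by rw [← hx', ← hy']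
  simp only [e, ε_even (hi.mul_right _), ε_even ((hi.add even_two).mul_right _),
    ε_odd (hi.add_one.mul hj.add_one)]
  linear_combination (norm := skip) s.x (2 * i) * hy - hx * s.y (2 * j)
    - q⁻¹ • (hy * s.x (2 * i) - s.y (2 * j) * hx) + (θ q * q⁻¹) • key
  simp only [mul_sub, sub_mul, mul_add, add_mul, smul_mul_assoc, mul_smul_comm, mul_assoc,
    smul_sub, smul_add, smul_smul]
  match_scalars <;> ring

lemma Central.sqComm_of_even (h : s.Central d) (hq0 : q ≠ 0) (hd : Even d) :
    s.sqComm (d + 1) = 0 := by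
  obtain ⟨i, rfl⟩ := hd
  rcases i with _ | i
  · simp [sqComm, fam_one, mul_assoc]
  rw [show i + 1 + (i + 1) = 2 * i + 2 by ring] at *
  have h2 : s.Central 2 := fun r hr ↦ h r (by omega)
  have h3 := h2.comm_fam_two_e hq0 0 (i + 1)
  have h4 := h2.comm_fam_two_e hq0 1 i
  have e1 := h.e_add_two (k := 0) (m := 2 * i + 2) (by omega)
  have e2 := h.e_add_two (k := 2) (m := 2 * i) (by omega)
  rw [h.e_eq (by omega), h.e_eq (k := 2 * 1 + 1) (by omega),
    h.e_eq (k := 2 * 1) (m := 2 * i + 1) (by omega)] at h4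
  rw [h.e_eq (by omega), h.e_eq (k := 2 * 0 + 1) (by omega),
    h.e_eq (k := 2 * 0) (m := 2 * (i + 1) + 1) (by omega)] at h3
  simp only [mul_one, mul_zero, zero_add, mul_add, fam_add_two,
    show 2 + 1 = 1 + 2 by rfl] at h3 h4 e1 e2
  rw [show 2 + 2 * i + 1 = 2 * i + 2 + 1 by ring, show 1 + 2 + 2 * i + 1 = 1 + (2 * i + 2) + 1 by ring,
    show 2 + (2 * i + 1) + 1 = 2 * i + 2 + 1 + 1 by ring, h3, e2, e1] at h4
  have h5 : (2 : ℂ) • s.sqComm (2 * i + 2 + 1) = 0 := by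
    rw [← sub_eq_zero] at h4
    rw [← neg_eq_zero, ← h4]
    module
  exact (smul_eq_zero_iff_right two_ne_zero).1 h5

/-- The recursion between the anticommutators of `fam 1 a` and `fam 0 (d + 3 - a)` for odd `a`. -/
lemma Central.anticomm_rec (h : s.Central d) (hq : NotRootOfUnity q) (hq0 : q ≠ 0) {a m : ℕ}
    (ha : Odd a) (hm : Even m) (ham : a + m = d) :
    s.fam 1 (a + 2) * s.fam 0 (m + 1) + s.fam 0 (m + 1) * s.fam 1 (a + 2) =
      s.fam 1 a * s.fam 0 (m + 3) + s.fam 0 (m + 3) * s.fam 1 a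
      + q ^ (a + 1) • s.sqComm (d + 1) + θ q • (s.fam 0 (m + 2) * s.fam 1 (a + 1) -
        s.fam 0 (a + 1) * s.fam 1 (m + 2)) := by
  have h1 := h.anticomm_fam_e hq hq0 ha (hm.add even_two) (by omega)
  have h2 := h.anticomm_fam_e hq hq0 (ha.add_even even_two) hm (by omega)
  rw [show Finset.range (a + 2) = Finset.range (a + 1 + 1) from rfl,
    Finset.sum_range_succ _ (a + 1), Finset.sum_range_succ _ a] at h2
  have h3 : ∑ j ∈ Finset.range a, (θ q * q ^ (a + 2 - 1 - j)) •
      (ε j • (s.e 0 (m + (a + 2) - j) * s.fam 1 j) - s.fam j j * s.e (a + 2 - j) m) =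
      q ^ 2 • (∑ j ∈ Finset.range a, (θ q * q ^ (a - 1 - j)) •
      (ε j • (s.e 0 (m + 2 + a - j) * s.fam 1 j) - s.fam j j * s.e (a - j) (m + 2))) +
      q ^ (a + 1) • s.sqComm (d + 1) := by
    rw [← sub_eq_iff_eq_add', Finset.smul_sum, ← Finset.sum_sub_distrib,
      Finset.sum_eq_single_of_mem 0 (Finset.mem_range.2 ha.pos)]
    · obtain ⟨b, rfl⟩ := Nat.exists_eq_add_of_lt ha.pos
      have hθ := hq.θ_ne_zero hq0
      rw [show 0 + b + 1 + 2 - 1 - 0 = b + 2 by omega, show 0 + b + 1 - 1 - 0 = b by omega,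
        Nat.sub_zero, Nat.sub_zero, Nat.sub_zero, Nat.sub_zero, h.e_add_two ham, fam_zero,
        show m + 2 + (0 + b + 1) = m + (0 + b + 1 + 2) by ring, fam_zero]
      simp only [ε_zero, one_smul, mul_sub, smul_mul_assoc, mul_smul_comm, one_mul, mul_one]
      match_scalars <;> field_simp <;> ring
    · intro j hj hj0
      have hj := Finset.mem_range.1 hj
      rw [h.e_eq (k := a + 2 - j) (m := m) (by omega), h.e_eq (k := a - j) (by omega), smul_smul,
        show a + 2 - j = a - j + 2 by omega, fam_add_two,
        show m + (a + 2) - j = m + 2 + a - j by omega,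
        show a - j + 2 + m + 1 = a - j + (m + 2) + 1 by ring,
        show a + 2 - 1 - j = a - 1 - j + 2 by omega, pow_add, sub_eq_zero]
      congr 1; ring
  rw [h3, ← h1, show a + 2 - 1 - a = 1 by omega, show a + 2 - 1 - (a + 1) = 0 by omega,
    show a + 2 - a = 2 by omega, show a + 2 - (a + 1) = 1 by omega, h.e_eq (k := 2) (by have := ha.pos; omega),
    h.e_eq (k := 1) (by have := ha.pos; omega), ε_odd ha, ε_even ha.add_one,
    s.fam_congr (c := a) (c' := 1) (Nat.odd_iff.1 ha),
    s.fam_congr (c := a + 1) (c' := 0) (Nat.even_iff.1 ha.add_one), fam_add_two,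
    show m + (a + 2) - a = m + 2 by omega, show m + (a + 2) - (a + 1) = m + 1 by omega,
    show 2 + m + 1 = m + 3 by ring,
    show 1 + m + 1 = m + 2 by ring, ← fam_zero_succ, ← fam_zero_succ, ← fam_zero_succ] at h2
  rw [h2]
  have hθ : θ q * q ^ 1 = q ^ 2 - 1 := by rw [θ]; field_simp
  rw [hθ]
  module

lemma Central.sqComm_of_odd (h : s.Central d) (hq : NotRootOfUnity q) (hq0 : q ≠ 0)
    (hd : Odd d) : s.sqComm (d + 1) = 0 := by
  obtain ⟨p, rfl⟩ := hd
  have hs : ∀ i ≤ p + 1, ∀ m, 2 * i + m = 2 * p + 2 →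
      s.fam 1 (2 * i + 1) * s.fam 0 (m + 1) + s.fam 0 (m + 1) * s.fam 1 (2 * i + 1) =
      s.fam 1 1 * s.fam 0 (2 * p + 3) + s.fam 0 (2 * p + 3) * s.fam 1 1
      + (∑ r ∈ Finset.range i, q ^ (2 * r + 2)) • s.sqComm (2 * p + 1 + 1)
      + θ q • ∑ r ∈ Finset.range i, (s.fam 0 (2 * p + 2 - 2 * r) * s.fam 1 (2 * r + 2) -
        s.fam 0 (2 * r + 2) * s.fam 1 (2 * p + 2 - 2 * r)) := by
    intro i
    induction i with
    | zero =>
      rintro - m hm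
      obtain rfl : m = 2 * p + 2 := by omega
      simp
    | succ i ih =>
      intro hi m hm
      have h1 := h.anticomm_rec hq hq0 (a := 2 * i + 1) (m := m) ⟨i, rfl⟩
        (Nat.even_iff.2 (by omega)) (by omega)
      rw [show m + 3 = (m + 2) + 1 by rfl, ih (by omega) (m + 2) (by omega)] at h1
      rw [Finset.sum_range_succ, Finset.sum_range_succ, show 2 * (i + 1) + 1 = 2 * i + 1 + 2 by ring,
        h1, show 2 * p + 2 - 2 * i = m + 2 by omega]
      module
  have hw : ∑ r ∈ Finset.range (p + 1), (s.fam 0 (2 * p + 2 - 2 * r) * s.fam 1 (2 * r + 2) -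
      s.fam 0 (2 * r + 2) * s.fam 1 (2 * p + 2 - 2 * r)) = 0 := by
    rw [Finset.sum_sub_distrib, sub_eq_zero, ← Finset.sum_range_reflect]
    refine Finset.sum_congr rfl fun r hr ↦ ?_
    have hr := Finset.mem_range.1 hr
    congr 2 <;> omega
  have h1 := hs (p + 1) le_rfl 0 (by ring)
  rw [hw, smul_zero, add_zero] at h1
  have h2 := s.odd_der_e 0 (2 * p + 2)
  have h3 := s.odd_der_e 1 (2 * p + 1)
  have h4 : s.e (1 + 1) (2 * p + 1) = _ := h.e_add_two (zero_add _)
  rw [ε_odd ⟨p + 1, by ring⟩, neg_one_smul, sub_neg_eq_add] at h2 h3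
  rw [zero_add, fam_one, fam_one, show 2 * (p + 1) + 1 = 2 * p + 1 + 2 by ring,
    fam_one_add_two, fam_zero_succ, add_comm, h3, h2, ε_zero, ε_one, h4] at h1
  have h5 : (1 + ∑ r ∈ Finset.range (p + 1), q ^ (2 * r + 2)) • s.sqComm (2 * p + 1 + 1) = 0 := by
    rw [← sub_eq_zero] at h1
    rw [← neg_eq_zero, ← h1]
    module
  refine (smul_eq_zero_iff_right ?_).1 h5
  refine hq.ne_zero_of_dvd (n := 2 * (p + 2)) (d := q ^ 2 - 1) (by omega) ?_
  rw [pow_mul, ← geom_sum_mul (q ^ 2) (p + 2), Finset.sum_range_succ' _ (p + 1), pow_zero, add_comm]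
  congr 2
  refine Finset.sum_congr rfl fun r _ ↦ ?_
  rw [← pow_mul, mul_add, mul_one]

/-- `L₁²` commutes with all imaginary root vectors. -/
theorem central (s : RootSystem q A) (hq : NotRootOfUnity q) (hq0 : q ≠ 0) (d : ℕ) :
    s.Central d := by
  induction d with
  | zero =>
    intro i hi
    rw [Nat.le_zero.1 hi, fam_zero]
    exact (Commute.one_right _).smul_right _
  | succ d ih =>
    intro i hi
    rcases hi.lt_or_eq with hi | rfl
    · exact ih i (by omega)
    · refine sub_eq_zero.1 ?_
      rcases d.even_or_odd with hd | hd
      · exact ih.sqComm_of_even hq0 hd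
      · exact ih.sqComm_of_odd hq hq0 hd

end RootSystem

/-- The common form of the sequences `P` (even `k`) and `Q` (odd `k`). -/
def PQ (q : ℂ) (k : ℕ) : ℕ → ℂ
  | 0 => 1
  | n + 1 => q ^ (n + 1) + ε k * q ^ n - ε (n + 1 + k) * PQ q k n

lemma PQ_of_even {k : ℕ} (hk : Even k) (n : ℕ) : PQ q k n = P q n := by
  induction n with
  | zero => rfl
  | succ n ih =>
    rw [PQ, P, ih, ε_even hk, ε_add, ε_add, ε_even hk, ε_one, ε]
    ring

lemma PQ_of_odd {k : ℕ} (hk : Odd k) (n : ℕ) : PQ q k n = Q q n := by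
  induction n with
  | zero => rfl
  | succ n ih =>
    rw [PQ, Q, ih, ε_odd hk, ε_add, ε_odd hk, ε]
    ring

namespace RootSystem

variable {A : Type*} [Ring A] [Algebra ℂ A] (s : RootSystem q A)

lemma fam_der (hq : NotRootOfUnity q) (hq0 : q ≠ 0) (b c n : ℕ) :
    s.l * s.fam b n - ε n • (s.fam b n * s.l) =
      ε c • (s.fam c (n + 1) - s.fam (c + 1) (n + 1)) := by
  have hc : ∀ c, ε c • (s.fam c (n + 1) - s.fam (c + 1) (n + 1)) =
      s.fam 0 (n + 1) - s.fam 1 (n + 1) := by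
    intro c
    induction c using Nat.twoStepInduction with
    | zero => rw [ε_zero, one_smul]
    | one => rw [ε_one]; simp [fam_add_two]
    | more c ih _ => rw [← ih, ε_add, ε_even even_two, mul_one]; rfl
  rw [hc]
  rcases n with _ | n
  · simp [fam_zero, fam_one, ε_zero]
  have h0 := s.fam_one_eq n
  induction b using Nat.twoStepInduction with
  | zero => rw [h0, sub_sub_cancel]
  | more b ih _ => exact ih
  | one =>
    rcases n with _ | n
    · simp only [zero_add, fam_one] at h0 ⊢
      rw [h0, sub_sub_cancel]
    · have h1 := s.fam_one_eq n
      have h2 := (s.central hq hq0 (n + 1) (n + 1) le_rfl).eq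
      rw [h0, sub_sub_cancel, h1]
      rw [← sub_eq_zero] at h2
      rw [← sub_eq_zero, ← neg_zero, ← h2]
      simp only [mul_sub, sub_mul, smul_mul_assoc, mul_smul_comm, mul_assoc,
        smul_sub, smul_smul, ε_add, ε_one]
      rcases ε_cases n with h | h <;> rw [h] <;> match_scalars <;> ring

/-- The bracket of `x k` with `fam k a`. -/
def hx' (a k : ℕ) : A := s.x k * s.fam k a - ε (k * a) • (s.fam k a * s.x k)

/-- The bracket of `fam (m + a + 1) a` with `y m`. -/
def gy' (a m : ℕ) : A :=
  s.fam (m + a + 1) a * s.y m - ε ((m + 1) * a) • (s.y m * s.fam (m + a + 1) a)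

lemma hx'_succ (hq : NotRootOfUnity q) (hq0 : q ≠ 0) (a k : ℕ) :
    s.hx' (a + 1) k = s.hx (a + 1) k + ε k • s.hx a (k + 1)
      + (s.l * s.hx' a k - ε (a + k) • (s.hx' a k * s.l)) := by
  have h := s.fam_der hq hq0 k k a
  have hx := s.x_succ k
  have h2 : s.fam k (a + 1) = s.fam (k + 1) (a + 1) +
      ε k • (s.l * s.fam k a - ε a • (s.fam k a * s.l)) := by
    rw [h, smul_smul, ε_mul_self]; module
  rw [hx', h2, RootSystem.hx, RootSystem.hx, hx', fam_add_two, hx]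
  simp only [mul_add, add_mul, mul_sub, sub_mul, smul_mul_assoc, mul_smul_comm, mul_assoc,
    smul_sub, smul_add, smul_smul, ε_add, one_mul, mul_one]
  rcases ε_cases k with h | h <;> rcases ε_cases a with h' | h' <;> simp only [h, h'] <;>
  match_scalars <;> ring

lemma gy'_succ (hq : NotRootOfUnity q) (hq0 : q ≠ 0) (a m : ℕ) :
    s.gy' (a + 1) m = s.gy (a + 1) m - ε m • s.gy a (m + 1)
      + (s.gy' a m * s.l + ε (a + m) • (s.l * s.gy' a m)) := by
  have h := s.fam_der hq hq0 (m + a + 1) (m + a) a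
  have hy := s.y_succ m
  have h2 : s.fam (m + a) (a + 1) = s.fam (m + a + 1) (a + 1) +
      ε (m + a) • (s.l * s.fam (m + a + 1) a - ε a • (s.fam (m + a + 1) a * s.l)) := by
    rw [h, smul_smul, ε_mul_self]; module
  rw [gy', show m + (a + 1) + 1 = m + a + 2 by ring, fam_add_two, h2, gy, gy, gy',
    ← add_assoc m, add_right_comm m 1 a, hy]
  simp only [mul_add, add_mul, mul_sub, sub_mul, smul_mul_assoc, mul_smul_comm, mul_assoc,
    smul_sub, smul_add, smul_smul, ε_add, ε_one, one_mul, mul_one]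
  rcases ε_cases m with h | h <;> rcases ε_cases a with h' | h' <;> simp only [h, h'] <;>
  match_scalars <;> ring

lemma der_fam_mul_x (hq : NotRootOfUnity q) (hq0 : q ≠ 0) {u j : ℕ} (hj : j ≤ u) :
    s.l * (s.fam (u + j) j * s.x (u - j)) - ε u • (s.fam (u + j) j * s.x (u - j) * s.l) =
      ε (u + j) • (s.fam (u + j) (j + 1) * s.x (u - j) - s.fam (u + j + 1) (j + 1) * s.x (u - j))
      - ε u • (s.fam (u + j) j * s.x (u + 1 - j)) := by
  obtain ⟨i, rfl⟩ := Nat.exists_eq_add_of_le hj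
  have h1 := s.fam_der hq hq0 (j + i + j) (j + i + j) j
  rw [show j + i + 1 - j = i + 1 by omega, Nat.add_sub_cancel_left, s.x_succ]
  simp only [ε_add] at *
  linear_combination (norm := skip) h1 * s.x i
  simp only [mul_sub, sub_mul, smul_mul_assoc, mul_smul_comm, mul_assoc, smul_sub, smul_smul]
  rcases ε_cases i with h | h <;> rcases ε_cases j with h' | h' <;> simp only [h, h'] <;>
  match_scalars <;> ring

lemma der_y_mul_fam (hq : NotRootOfUnity q) (hq0 : q ≠ 0) {u j : ℕ} (hj : j ≤ u) :
    s.y (u - j) * s.fam (u + 1) j * s.l + ε u • (s.l * (s.y (u - j) * s.fam (u + 1) j)) =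
      ε (u + j) • (s.y (u - j) * s.fam (u + 1) (j + 1) - s.y (u - j) * s.fam (u + 2) (j + 1))
      + ε u • (s.y (u + 1 - j) * s.fam (u + 1) j) := by
  obtain ⟨i, rfl⟩ := Nat.exists_eq_add_of_le hj
  have h1 := s.fam_der hq hq0 (j + i + 1) (j + i + 1) j
  rw [show j + i + 1 - j = i + 1 by omega, Nat.add_sub_cancel_left, s.y_succ]
  simp only [ε_add, ε_one] at *
  linear_combination (norm := skip) (-ε j) • (s.y i * h1)
  simp only [mul_sub, add_mul, smul_mul_assoc, mul_smul_comm, mul_assoc,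
    smul_sub, smul_add, smul_smul]
  rcases ε_cases i with h | h <;> rcases ε_cases j with h' | h' <;> simp only [h, h'] <;>
  match_scalars <;> ring

lemma hx'_sum (hq : NotRootOfUnity q) (hq0 : q ≠ 0) (a k : ℕ) :
    s.hx' a k = ∑ j ∈ Finset.range a, (ε ((a + k + j) * j) * θ q * PQ q k (a - 1 - j)) •
      (s.fam (k + a + j) j * s.x (k + a - j)) := by
  induction a with
  | zero => simp [hx', fam_zero, ε_zero]
  | succ a ih =>
    let z (j : ℕ) : A := s.fam (k + a + j) j * s.x (k + a + 1 - j)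
    let w (j : ℕ) : A := s.fam (k + a + j) (j + 1) * s.x (k + a - j)
    have hz0 : z 0 = s.fam (k + (a + 1) + 0) 0 * s.x (k + (a + 1) - 0) := by
      simp only [z, fam_zero]; rfl
    have h1 : s.hx (a + 1) k = ∑ j ∈ Finset.range (a + 1),
        (ε ((k + a) * j) * θ q * q ^ (a - j)) • z j := by
      rw [(s.central hq hq0 (a + 1 + k)).hx_sum hq hq0 (by omega)]
      refine Finset.sum_congr rfl fun j hj ↦ ?_
      rw [s.fam_congr (c := k + 1 + (a + 1) + j) (c' := k + a + j) (by omega), Nat.add_sub_cancel,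
        show (a + 1 + k + 1) * j = (k + a) * j + 2 * j by ring, ε_add_two_mul]
      rfl
    have h2 : s.hx a (k + 1) = ∑ j ∈ Finset.range a,
        (ε ((k + a) * j) * θ q * q ^ (a - 1 - j)) • z j := by
      rw [(s.central hq hq0 (a + (k + 1))).hx_sum hq hq0 (by omega)]
      refine Finset.sum_congr rfl fun j hj ↦ ?_
      rw [s.fam_congr (c := k + 1 + 1 + a + j) (c' := k + a + j) (by omega),
        show (a + (k + 1) + 1) * j = (k + a) * j + 2 * j by ring, ε_add_two_mul, add_right_comm k 1]
    have h3 : s.l * s.hx' a k - ε (a + k) • (s.hx' a k * s.l) =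
        (∑ j ∈ Finset.range a,
          (ε ((a + 1 + k + (j + 1)) * (j + 1)) * θ q * PQ q k (a - 1 - j)) • w j)
        - (∑ j ∈ Finset.range a,
          (ε ((k + a) * (j + 1)) * θ q * PQ q k (a - (j + 1))) • z (j + 1))
        - ∑ j ∈ Finset.range a,
          (ε ((k + a) * j) * ε j * ε (k + a) * θ q * PQ q k (a - 1 - j)) • z j := by
      rw [ih, Finset.mul_sum, Finset.sum_mul, Finset.smul_sum, ← Finset.sum_sub_distrib,
        ← Finset.sum_sub_distrib, ← Finset.sum_sub_distrib]
      refine Finset.sum_congr rfl fun j hj ↦ ?_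
      have hj := Finset.mem_range.1 hj
      have h4 := s.der_fam_mul_x hq hq0 (u := k + a) (j := j) (by omega)
      rw [mul_smul_comm, smul_mul_assoc, smul_comm, ← smul_sub, add_comm a k, h4]
      have e1 : ε ((a + 1 + k + (j + 1)) * (j + 1)) = ε ((k + a + j) * j) * ε (k + a + j) := by
        rw [← ε_add]; refine ε_congr ?_
        simp only [parity_simps]; tauto
      have e2 : ε ((k + a) * (j + 1)) = ε ((k + a + j) * j) * ε (k + a + j) := by
        rw [← ε_add]; refine ε_congr ?_
        simp only [parity_simps]; tauto
      have e3 : ε ((k + a) * j) * ε j = ε ((k + a + j) * j) := by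
        rw [← ε_add]; refine ε_congr ?_
        simp only [parity_simps]; tauto
      simp only [z, w]
      rw [e1, e2, e3, Nat.add_sub_add_right, show a - (j + 1) = a - 1 - j by omega, ← add_assoc]
      module
    rw [hx'_succ _ hq hq0, h3, Finset.sum_range_succ' _ a, ← hz0, h1, h2]
    have h5 : ∑ j ∈ Finset.range (a + 1), (ε ((k + a) * j) * θ q * PQ q k (a - j)) • z j =
        ∑ j ∈ Finset.range (a + 1), (ε ((k + a) * j) * θ q * q ^ (a - j)) • z j
        + ε k • ∑ j ∈ Finset.range a, (ε ((k + a) * j) * θ q * q ^ (a - 1 - j)) • z j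
        - ∑ j ∈ Finset.range a,
          (ε ((k + a) * j) * ε j * ε (k + a) * θ q * PQ q k (a - 1 - j)) • z j := by
      rw [Finset.sum_range_succ, Finset.sum_range_succ, Nat.sub_self, PQ, pow_zero,
        Finset.smul_sum, add_right_comm, add_sub_right_comm, ← Finset.sum_add_distrib,
        ← Finset.sum_sub_distrib]
      congr 1
      refine Finset.sum_congr rfl fun j hj ↦ ?_
      obtain ⟨i, rfl⟩ := Nat.exists_eq_add_of_lt (Finset.mem_range.1 hj)
      have e1 : ε (i + 1 + k) = ε j * ε (k + (j + i + 1)) := by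
        rw [← ε_add]; refine ε_congr ?_
        simp only [parity_simps]; tauto
      rw [show j + i + 1 - j = i + 1 by omega, show j + i + 1 - 1 - j = i by omega, PQ, e1]
      module
    rw [Finset.sum_range_succ', Nat.sub_zero, mul_zero] at h5
    rw [show a + 1 - 1 - 0 = a by omega, mul_zero]
    have h6 : ∑ j ∈ Finset.range a, (ε ((a + 1 + k + (j + 1)) * (j + 1)) * θ q *
        PQ q k (a + 1 - 1 - (j + 1))) • (s.fam (k + (a + 1) + (j + 1)) (j + 1) *
          s.x (k + (a + 1) - (j + 1))) = ∑ j ∈ Finset.range a,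
          (ε ((a + 1 + k + (j + 1)) * (j + 1)) * θ q * PQ q k (a - 1 - j)) • w j := by
      refine Finset.sum_congr rfl fun j hj ↦ ?_
      rw [show a + 1 - 1 - (j + 1) = a - 1 - j by omega,
        s.fam_congr (c := k + (a + 1) + (j + 1)) (c' := k + a + j) (by omega),
        show k + (a + 1) - (j + 1) = k + a - j by omega]
    rw [h6, ← sub_eq_zero]
    rw [← sub_eq_zero] at h5
    rw [← neg_zero, ← h5]
    abel

lemma gy'_sum (hq : NotRootOfUnity q) (hq0 : q ≠ 0) (a m : ℕ) :
    s.gy' a m = ∑ j ∈ Finset.range a, (ε ((a + m + j + 1) * j) * θ q * PQ q (m + 1) (a - 1 - j)) •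
      (s.y (m + a - j) * s.fam (m + a + 1) j) := by
  induction a with
  | zero => simp [gy', fam_zero, ε_zero]
  | succ a ih =>
    let z (j : ℕ) : A := s.y (m + a + 1 - j) * s.fam (m + a + 1) j
    let w (j : ℕ) : A := s.y (m + a - j) * s.fam (m + a + 2) (j + 1)
    have hz0 : z 0 = s.y (m + (a + 1) - 0) * s.fam (m + (a + 1) + 1) 0 := by
      simp only [z, fam_zero]; rfl
    have h1 : s.gy (a + 1) m = ∑ j ∈ Finset.range (a + 1),
        (ε ((m + a + 1) * j) * θ q * q ^ (a - j)) • z j := by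
      rw [(s.central hq hq0 (a + 1 + m)).gy_sum hq hq0 (by omega)]
      rfl
    have h2 : s.gy a (m + 1) = ∑ j ∈ Finset.range a,
        (ε ((m + a + 1) * j) * θ q * q ^ (a - 1 - j)) • z j := by
      rw [(s.central hq hq0 (a + (m + 1))).gy_sum hq hq0 (by omega), add_right_comm m 1]
    have h3 : s.gy' a m * s.l + ε (a + m) • (s.l * s.gy' a m) =
        (∑ j ∈ Finset.range a,
          (ε ((a + 1 + m + (j + 1) + 1) * (j + 1)) * θ q * PQ q (m + 1) (a - 1 - j)) • w j)
        - (∑ j ∈ Finset.range a,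
          (ε ((m + a + 1) * (j + 1)) * θ q * PQ q (m + 1) (a - (j + 1))) • z (j + 1))
        + ∑ j ∈ Finset.range a,
          (ε ((m + a + 1) * j) * ε j * ε (m + a) * θ q * PQ q (m + 1) (a - 1 - j)) • z j := by
      rw [ih, Finset.mul_sum, Finset.sum_mul, Finset.smul_sum, ← Finset.sum_add_distrib,
        ← Finset.sum_sub_distrib, ← Finset.sum_add_distrib]
      refine Finset.sum_congr rfl fun j hj ↦ ?_
      have hj := Finset.mem_range.1 hj
      have h4 := s.der_y_mul_fam hq hq0 (u := m + a) (j := j) (by omega)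
      rw [mul_smul_comm, smul_mul_assoc, smul_comm, ← smul_add, add_comm a m, h4]
      have e1 : ε ((a + 1 + m + (j + 1) + 1) * (j + 1)) =
          - (ε ((m + a + j + 1) * j) * ε (m + a + j)) := by
        rw [← ε_add, ← neg_one_mul, ← ε_one, ← ε_add]; refine ε_congr ?_
        simp only [parity_simps, Nat.not_even_one]; tauto
      have e2 : ε ((m + a + 1) * (j + 1)) = - (ε ((m + a + j + 1) * j) * ε (m + a + j)) := by
        rw [← ε_add, ← neg_one_mul, ← ε_one, ← ε_add]; refine ε_congr ?_
        simp only [parity_simps, Nat.not_even_one]; tauto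
      have e3 : ε ((m + a + 1) * j) * ε j = ε ((m + a + j + 1) * j) := by
        rw [← ε_add]; refine ε_congr ?_
        simp only [parity_simps]; tauto
      simp only [z, w]
      rw [e1, e2, e3, Nat.add_sub_add_right, show a - (j + 1) = a - 1 - j by omega]
      module
    have h5 : ∑ j ∈ Finset.range (a + 1),
        (ε ((m + a + 1) * j) * θ q * PQ q (m + 1) (a - j)) • z j =
        ∑ j ∈ Finset.range (a + 1), (ε ((m + a + 1) * j) * θ q * q ^ (a - j)) • z j
        - ε m • ∑ j ∈ Finset.range a, (ε ((m + a + 1) * j) * θ q * q ^ (a - 1 - j)) • z j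
        + ∑ j ∈ Finset.range a,
          (ε ((m + a + 1) * j) * ε j * ε (m + a) * θ q * PQ q (m + 1) (a - 1 - j)) • z j := by
      rw [Finset.sum_range_succ, Finset.sum_range_succ, Nat.sub_self, PQ, pow_zero,
        Finset.smul_sum, add_sub_right_comm, add_right_comm (_ - _), ← Finset.sum_sub_distrib,
        ← Finset.sum_add_distrib]
      congr 1
      refine Finset.sum_congr rfl fun j hj ↦ ?_
      obtain ⟨i, rfl⟩ := Nat.exists_eq_add_of_lt (Finset.mem_range.1 hj)
      have e1 : ε (i + 1 + (m + 1)) = - (ε j * ε (m + (j + i + 1))) := by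
        rw [← ε_add, ← neg_one_mul, ← ε_one, ← ε_add]; refine ε_congr ?_
        simp only [parity_simps, Nat.not_even_one]; tauto
      rw [show j + i + 1 - j = i + 1 by omega, show j + i + 1 - 1 - j = i by omega, PQ, e1,
        ε_add m 1, ε_one]
      module
    rw [gy'_succ _ hq hq0, h3, Finset.sum_range_succ' _ a, ← hz0, h1, h2]
    rw [Finset.sum_range_succ', Nat.sub_zero, mul_zero] at h5
    rw [show a + 1 - 1 - 0 = a by omega, mul_zero]
    have h6 : ∑ j ∈ Finset.range a, (ε ((a + 1 + m + (j + 1) + 1) * (j + 1)) * θ q *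
        PQ q (m + 1) (a + 1 - 1 - (j + 1))) • (s.y (m + (a + 1) - (j + 1)) *
          s.fam (m + (a + 1) + 1) (j + 1)) = ∑ j ∈ Finset.range a,
        (ε ((a + 1 + m + (j + 1) + 1) * (j + 1)) * θ q * PQ q (m + 1) (a - 1 - j)) • w j := by
      refine Finset.sum_congr rfl fun j hj ↦ ?_
      rw [show a + 1 - 1 - (j + 1) = a - 1 - j by omega,
        show m + (a + 1) - (j + 1) = m + a - j by omega]
      rfl
    rw [h6, ← sub_eq_zero]
    rw [← sub_eq_zero] at h5
    rw [← neg_zero, ← h5]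
    abel

end RootSystem

lemma sub_pow_succ_smul {A : Type*} [Ring A] [Algebra ℂ A] (k : ℕ) (a b : A) :
    a - (-1 : ℂ) ^ (k + 1) • b = a + ε k • b := by
  rw [pow_succ, mul_neg_one, neg_smul, sub_neg_eq_add, ε]

lemma serre_one (q : ℂ) : X q 1 * X q 2 = q • (X q 2 * X q 1) := by
  have h := RingQuot.mkAlgHom_rel ℂ (Rel.one (q := q))
  change π q _ = π q _ at h
  simp only [serre1, X2F, L1F, map_sub, map_mul, map_smul, map_zero, sub_eq_zero] at h
  simpa only [X, L1U, pow_zero, one_smul] using h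

lemma Y_add_two (k : ℕ) : Y q (k + 2) = L1U q * Y q (k + 1) + ε k • (Y q (k + 1) * L1U q) :=
  sub_pow_succ_smul k _ _

lemma serre_two (q : ℂ) : Y q 2 * Y q 1 = q • (Y q 1 * Y q 2) := by
  have h := RingQuot.mkAlgHom_rel ℂ (Rel.two (q := q))
  change π q _ = π q _ at h
  simp only [serre2, Y2F, L1F, map_sub, map_add, map_mul, map_smul, map_zero, sub_eq_zero] at h
  rw [Y_add_two, zero_add, ε_zero, one_smul]
  exact h

/-- The root vectors of `U`. -/
def rootSystem (q : ℂ) : RootSystem q (U q) where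
  x k := X q (k + 1)
  y k := Y q (k + 1)
  l := L1U q
  l_eq := rfl
  x_succ _ := rfl
  y_succ k := Y_add_two k
  serre_x := serre_one q
  serre_y := serre_two q

lemma rootSystem_fam_even {c : ℕ} (hc : Even c) (n : ℕ) : (rootSystem q).fam c n = L q n := by
  rw [RootSystem.fam_congr (c' := 0) _ (Nat.even_iff.1 hc)]
  cases n with
  | zero => rfl
  | succ n => rw [RootSystem.fam, RootSystem.e, L, zero_mul, ε_zero, one_mul]; rfl

lemma rootSystem_fam_odd {c : ℕ} (hc : Odd c) (n : ℕ) : (rootSystem q).fam c n = L' q n := by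
  rw [RootSystem.fam_congr (c' := 1) _ (Nat.odd_iff.1 hc)]
  match n with
  | 0 => rfl
  | 1 => rw [RootSystem.fam, RootSystem.e, L', L, zero_mul, ε_zero, one_mul]; rfl
  | n + 2 => rw [RootSystem.fam, RootSystem.e, L', one_mul]; rfl

lemma sum_range_two_mul {M : Type*} [AddCommMonoid M] (f : ℕ → M) (n : ℕ) :
    ∑ j ∈ Finset.range (2 * n), f j =
      ∑ i ∈ Finset.range n, f (2 * i) + ∑ i ∈ Finset.range n, f (2 * i + 1) := by
  induction n with
  | zero => simp
  | succ n ih =>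
    rw [mul_add_one, Finset.sum_range_succ, Finset.sum_range_succ, ih, Finset.sum_range_succ,
      Finset.sum_range_succ]
    abel

lemma sum_alternating {A : Type*} [Ring A] [Algebra ℂ A] {e : ℕ → ℕ} (c : ℕ → ℂ) (z : ℕ → A)
    (n : ℕ)
    (he : ∀ i, Even (e (2 * i))) (ho : ∀ i, Odd (e (2 * i + 1))) :
    ∑ j ∈ Finset.range (2 * n), (ε (e j) * θ q * c (2 * n - 1 - j)) • z j =
      ∑ i ∈ Finset.range n, (c (2 * n - 1 - 2 * i) * θ q) • z (2 * i) -
        ∑ i ∈ Finset.range n, (c (2 * n - 2 - 2 * i) * θ q) • z (2 * i + 1) := by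
  rw [sum_range_two_mul, sub_eq_add_neg, ← Finset.sum_neg_distrib]
  congr 1 <;> refine Finset.sum_congr rfl fun i _ ↦ ?_
  · rw [ε_even (he i), one_mul, mul_comm]
  · rw [ε_odd (ho i), show 2 * n - 2 - 2 * i = 2 * n - 1 - (2 * i + 1) by omega]
    module

lemma sum_nonalternating {A : Type*} [Ring A] [Algebra ℂ A] {e : ℕ → ℕ} (c : ℕ → ℂ) (z : ℕ → A)
    (n : ℕ) (he : ∀ j, Even (e j)) :
    ∑ j ∈ Finset.range (2 * n), (ε (e j) * θ q * c (2 * n - 1 - j)) • z j =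
      ∑ i ∈ Finset.range n, (c (2 * n - 1 - 2 * i) * θ q) • z (2 * i) +
        ∑ i ∈ Finset.range n, (c (2 * n - 2 - 2 * i) * θ q) • z (2 * i + 1) := by
  rw [sum_range_two_mul]
  congr 1 <;> refine Finset.sum_congr rfl fun i _ ↦ ?_
  · rw [ε_even (he _), one_mul, mul_comm]
  · rw [ε_even (he _), show 2 * n - 2 - 2 * i = 2 * n - 1 - (2 * i + 1) by omega, one_mul, mul_comm]

end QAff

/-- In `U = U_q(A(0,2)^{(4)})^+`, for every `n ≥ 1`, the eight commutation identities of
Proposition 2.6 hold (all brackets are plain commutators; `L₀ = L₀′ = θ⁻¹·1`). -/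
theorem stmt15 (q : ℂ) (hq0 : q ≠ 0) (hq : NotRootOfUnity q) (n : ℕ) (hn : 1 ≤ n) :
    (X q 1 * L q (2*n) - L q (2*n) * X q 1
      = (∑ i ∈ Finset.range n, (P q (2*n-1-2*i) * θ q) • (L q (2*i) * X q (2*n+1-2*i)))
        - ∑ i ∈ Finset.range n, (P q (2*n-2-2*i) * θ q) • (L' q (2*i+1) * X q (2*n-2*i))) ∧
    (X q 1 * L' q (2*n) - L' q (2*n) * X q 1
      = (∑ i ∈ Finset.range n, (q^(2*n-1-2*i) * θ q) • (L' q (2*i) * X q (2*n+1-2*i)))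
        - ∑ i ∈ Finset.range n, (q^(2*n-2-2*i) * θ q) • (L q (2*i+1) * X q (2*n-2*i))) ∧
    (X q 2 * L q (2*n) - L q (2*n) * X q 2
      = (∑ i ∈ Finset.range n, (q^(2*n-1-2*i) * θ q) • (L q (2*i) * X q (2*n+2-2*i)))
        + ∑ i ∈ Finset.range n, (q^(2*n-2-2*i) * θ q) • (L' q (2*i+1) * X q (2*n-2*i+1))) ∧
    (X q 2 * L' q (2*n) - L' q (2*n) * X q 2
      = (∑ i ∈ Finset.range n, (Q q (2*n-1-2*i) * θ q) • (L' q (2*i) * X q (2*n+2-2*i)))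
        + ∑ i ∈ Finset.range n, (Q q (2*n-2-2*i) * θ q) • (L q (2*i+1) * X q (2*n-2*i+1))) ∧
    (L q (2*n) * Y q 1 - Y q 1 * L q (2*n)
      = (∑ i ∈ Finset.range n, (q^(2*n-1-2*i) * θ q) • (Y q (2*n+1-2*i) * L q (2*i)))
        + ∑ i ∈ Finset.range n, (q^(2*n-2-2*i) * θ q) • (Y q (2*n-2*i) * L q (2*i+1))) ∧
    (L' q (2*n) * Y q 1 - Y q 1 * L' q (2*n)
      = (∑ i ∈ Finset.range n, (Q q (2*n-1-2*i) * θ q) • (Y q (2*n+1-2*i) * L' q (2*i)))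
        + ∑ i ∈ Finset.range n, (Q q (2*n-2-2*i) * θ q) • (Y q (2*n-2*i) * L' q (2*i+1))) ∧
    (L q (2*n) * Y q 2 - Y q 2 * L q (2*n)
      = (∑ i ∈ Finset.range n, (P q (2*n-1-2*i) * θ q) • (Y q (2*n+2-2*i) * L q (2*i)))
        - ∑ i ∈ Finset.range n, (P q (2*n-2-2*i) * θ q) • (Y q (2*n-2*i+1) * L q (2*i+1))) ∧
    (L' q (2*n) * Y q 2 - Y q 2 * L' q (2*n)
      = (∑ i ∈ Finset.range n, (q^(2*n-1-2*i) * θ q) • (Y q (2*n+2-2*i) * L' q (2*i)))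
        - ∑ i ∈ Finset.range n, (q^(2*n-2-2*i) * θ q) • (Y q (2*n-2*i+1) * L' q (2*i+1))) := by
  let s := rootSystem q
  have hc (d : ℕ) : s.Central d := s.central hq hq0 d
  refine ⟨?_, ?_, ?_, ?_, ?_, ?_, ?_, ?_⟩
  · have h := s.hx'_sum hq hq0 (2 * n) 0
    rw [RootSystem.hx', rootSystem_fam_even (by simp [parity_simps]),
      ε_even (by simp [parity_simps]), one_smul,
      sum_alternating _ _ _ (fun i ↦ by simp [parity_simps]) (fun i ↦ by simp [parity_simps])] at h
    refine h.trans ?_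
    congr 1 <;> refine Finset.sum_congr rfl fun i hi ↦ ?_ <;> have hi := Finset.mem_range.1 hi
    · rw [PQ_of_even (by simp [parity_simps]), rootSystem_fam_even (by simp [parity_simps]),
        show 2 * n + 1 - 2 * i = 0 + 2 * n - 2 * i + 1 by omega]
      rfl
    · rw [PQ_of_even (by simp [parity_simps]), rootSystem_fam_odd (by simp [parity_simps]),
        show 2 * n - 2 * i = 0 + 2 * n - (2 * i + 1) + 1 by omega]
      rfl
  · have h := (hc (2 * n + 0)).hx_sum hq hq0 (by omega : 2 * n + 0 ≤ _)
    rw [RootSystem.hx, rootSystem_fam_odd (by simp [parity_simps]),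
      ε_even (by simp [parity_simps]), one_smul,
      sum_alternating _ _ _ (fun i ↦ by simp [parity_simps]) (fun i ↦ by simp [parity_simps])] at h
    refine h.trans ?_
    congr 1 <;> refine Finset.sum_congr rfl fun i hi ↦ ?_ <;> have hi := Finset.mem_range.1 hi
    · rw [rootSystem_fam_odd (by simp [parity_simps]),
        show 2 * n + 1 - 2 * i = 0 + 2 * n - 2 * i + 1 by omega]
      rfl
    · rw [rootSystem_fam_even (by simp [parity_simps]),
        show 2 * n - 2 * i = 0 + 2 * n - (2 * i + 1) + 1 by omega]
      rfl
  · have h := (hc (2 * n + 1)).hx_sum hq hq0 (by omega : 2 * n + 1 ≤ _)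
    rw [RootSystem.hx, rootSystem_fam_even (by simp [parity_simps]),
      ε_even (by simp [parity_simps]), one_smul,
      sum_nonalternating _ _ _ (fun j ↦ by simp [parity_simps])] at h
    refine h.trans ?_
    congr 1 <;> refine Finset.sum_congr rfl fun i hi ↦ ?_ <;> have hi := Finset.mem_range.1 hi
    · rw [rootSystem_fam_even (by simp [parity_simps]),
        show 2 * n + 2 - 2 * i = 1 + 2 * n - 2 * i + 1 by omega]
      rfl
    · rw [rootSystem_fam_odd (by simp [parity_simps]),
        show 2 * n - 2 * i + 1 = 1 + 2 * n - (2 * i + 1) + 1 by omega]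
      rfl
  · have h := s.hx'_sum hq hq0 (2 * n) 1
    rw [RootSystem.hx', rootSystem_fam_odd (by simp [parity_simps]),
      ε_even (by simp [parity_simps]), one_smul,
      sum_nonalternating _ _ _ (fun j ↦ by
        simpa [parity_simps] using (Nat.even_or_odd j).symm)] at h
    refine h.trans ?_
    congr 1 <;> refine Finset.sum_congr rfl fun i hi ↦ ?_ <;> have hi := Finset.mem_range.1 hi
    · rw [PQ_of_odd (by simp [parity_simps]), rootSystem_fam_odd (by simp [parity_simps]),
        show 2 * n + 2 - 2 * i = 1 + 2 * n - 2 * i + 1 by omega]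
      rfl
    · rw [PQ_of_odd (by simp [parity_simps]), rootSystem_fam_even (by simp [parity_simps]),
        show 2 * n - 2 * i + 1 = 1 + 2 * n - (2 * i + 1) + 1 by omega]
      rfl
  · have h := (hc (2 * n + 0)).gy_sum hq hq0 (by omega : 2 * n + 0 ≤ _)
    rw [RootSystem.gy, rootSystem_fam_even (by simp [parity_simps]),
      ε_even (by simp [parity_simps]), one_smul,
      sum_nonalternating _ _ _ (fun j ↦ by simp [parity_simps])] at h
    refine h.trans ?_
    congr 1 <;> refine Finset.sum_congr rfl fun i hi ↦ ?_ <;> have hi := Finset.mem_range.1 hi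
    · rw [rootSystem_fam_even (by simp [parity_simps]),
        show 2 * n + 1 - 2 * i = 0 + 2 * n - 2 * i + 1 by omega]
      rfl
    · rw [rootSystem_fam_even (by simp [parity_simps]),
        show 2 * n - 2 * i = 0 + 2 * n - (2 * i + 1) + 1 by omega]
      rfl
  · have h := s.gy'_sum hq hq0 (2 * n) 0
    rw [RootSystem.gy', rootSystem_fam_odd (by simp [parity_simps]),
      ε_even (by simp [parity_simps]), one_smul,
      sum_nonalternating _ _ _ (fun j ↦ by
        simpa [parity_simps] using (Nat.even_or_odd j).symm)] at h
    refine h.trans ?_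
    congr 1 <;> refine Finset.sum_congr rfl fun i hi ↦ ?_ <;> have hi := Finset.mem_range.1 hi
    · rw [PQ_of_odd (by simp [parity_simps]), rootSystem_fam_odd (by simp [parity_simps]),
        show 2 * n + 1 - 2 * i = 0 + 2 * n - 2 * i + 1 by omega]
      rfl
    · rw [PQ_of_odd (by simp [parity_simps]), rootSystem_fam_odd (by simp [parity_simps]),
        show 2 * n - 2 * i = 0 + 2 * n - (2 * i + 1) + 1 by omega]
      rfl
  · have h := s.gy'_sum hq hq0 (2 * n) 1
    rw [RootSystem.gy', rootSystem_fam_even (by simp [parity_simps]),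
      ε_even (by simp [parity_simps]), one_smul,
      sum_alternating _ _ _ (fun i ↦ by simp [parity_simps]) (fun i ↦ by simp [parity_simps])] at h
    refine h.trans ?_
    congr 1 <;> refine Finset.sum_congr rfl fun i hi ↦ ?_ <;> have hi := Finset.mem_range.1 hi
    · rw [PQ_of_even (by simp [parity_simps]), rootSystem_fam_even (by simp [parity_simps]),
        show 2 * n + 2 - 2 * i = 1 + 2 * n - 2 * i + 1 by omega]
      rfl
    · rw [PQ_of_even (by simp [parity_simps]), rootSystem_fam_even (by simp [parity_simps]),
        show 2 * n - 2 * i + 1 = 1 + 2 * n - (2 * i + 1) + 1 by omega]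
      rfl
  · have h := (hc (2 * n + 1)).gy_sum hq hq0 (by omega : 2 * n + 1 ≤ _)
    rw [RootSystem.gy, rootSystem_fam_odd (by simp [parity_simps]),
      ε_even (by simp [parity_simps]), one_smul,
      sum_alternating _ _ _ (fun i ↦ by simp [parity_simps]) (fun i ↦ by simp [parity_simps])] at h
    refine h.trans ?_
    congr 1 <;> refine Finset.sum_congr rfl fun i hi ↦ ?_ <;> have hi := Finset.mem_range.1 hi
    · rw [rootSystem_fam_odd (by simp [parity_simps]),
        show 2 * n + 2 - 2 * i = 1 + 2 * n - 2 * i + 1 by omega]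
      rfl
    · rw [rootSystem_fam_odd (by simp [parity_simps]),
        show 2 * n - 2 * i + 1 = 1 + 2 * n - (2 * i + 1) + 1 by omega]
      rfl
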